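/- Finitely many copies of any GME pure state are GMNL: let n ≥ 2, d ≥ 2, and let |Ψ⟩ ∈ (ℂ^d)^{⊗n} be a genuinely multipartite entangled pure state, i.e. |Ψ⟩ is not a product |ψ_M⟩⊗|ψ_{M̄}⟩ across any bipartition of the n parties into a nonempty proper subset M and its complement. Then the n-partite state (|Ψ⟩⟨Ψ|)^{⊗(n−1)}, in which party i holds the i-th tensor factor of each of the n−1 copies, is GMNL. -/

import Mathlib

open Matrix Finset
open scoped ComplexOrder

attribute [local instance] Classical.propDecidable

noncomputable section

/-- The rank-one matrix `|v⟩⟨v|` associated to a vector `v`. -/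
def vecProj {D : Type*} [Fintype D] (v : D → ℂ) : Matrix D D ℂ :=
  Matrix.of fun i j => v i * star (v j)

/-- `v` is a unit vector. -/
def UnitVec {D : Type*} [Fintype D] (v : D → ℂ) : Prop :=
  ∑ i, star (v i) * v i = 1

/-- A quantum state: positive semidefinite matrix of trace one. -/
def IsState {D : Type*} [Fintype D] [DecidableEq D] (ρ : Matrix D D ℂ) : Prop :=
  ρ.PosSemidef ∧ ρ.trace = 1

/-- A vector on a multipartite system is fully product if it is a tensor product of
single-party vectors. -/
def IsProdVec {ι : Type*} [Fintype ι] {Idx : ι → Type*} (v : (∀ i, Idx i) → ℂ) : Prop :=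
  ∃ ψ : ∀ i, Idx i → ℂ, ∀ f, v f = ∏ i, ψ i (f i)

/-- A vector on a multipartite system is biseparable if it is a product across some
bipartition of the parties into a nonempty proper subset `M` and its complement. -/
def IsBisepVec {ι : Type*} [Fintype ι] {Idx : ι → Type*} (v : (∀ i, Idx i) → ℂ) : Prop :=
  ∃ M : Finset ι, M.Nonempty ∧ M ≠ Finset.univ ∧
    ∃ (a : ((j : {j : ι // j ∈ M}) → Idx j.1) → ℂ)
      (b : ((j : {j : ι // j ∉ M}) → Idx j.1) → ℂ),
      ∀ f, v f = a (fun j => f j.1) * b (fun j => f j.1)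

/-- Fully separable states: finite convex combinations of fully product pure states. -/
def FullySepState {ι : Type*} [Fintype ι] [DecidableEq ι] (Idx : ι → Type*)
    [∀ i, Fintype (Idx i)] (ρ : Matrix (∀ i, Idx i) (∀ i, Idx i) ℂ) : Prop :=
  ∃ (m : ℕ) (w : Fin m → ℝ) (u : Fin m → (∀ i, Idx i) → ℂ),
    (∀ k, 0 ≤ w k) ∧ (∑ k, w k = 1) ∧
    (∀ k, UnitVec (u k) ∧ IsProdVec (u k)) ∧
    ρ = ∑ k, (w k : ℂ) • vecProj (u k)

/-- Biseparable states: finite convex combinations of biseparable pure states. -/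
def BisepState {ι : Type*} [Fintype ι] [DecidableEq ι] (Idx : ι → Type*)
    [∀ i, Fintype (Idx i)] (ρ : Matrix (∀ i, Idx i) (∀ i, Idx i) ℂ) : Prop :=
  ∃ (m : ℕ) (w : Fin m → ℝ) (u : Fin m → (∀ i, Idx i) → ℂ),
    (∀ k, 0 ≤ w k) ∧ (∑ k, w k = 1) ∧
    (∀ k, UnitVec (u k) ∧ IsBisepVec (u k)) ∧
    ρ = ∑ k, (w k : ℂ) • vecProj (u k)

/-- An `ι`-partite box: nonnegative entries summing to one over outputs for each input. -/
def IsBoxN {ι : Type*} [Fintype ι] [DecidableEq ι] {X A : ι → Type*}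
    [∀ i, Fintype (X i)] [∀ i, Fintype (A i)]
    (P : (∀ i, X i) → (∀ i, A i) → ℝ) : Prop :=
  (∀ x a, 0 ≤ P x a) ∧ ∀ x, ∑ a, P x a = 1

/-- A box is nonsignalling if the marginal distribution of the outputs of any subset `T`
of parties depends only on the inputs of the parties in `T`. -/
def NonSignalling {ι : Type*} [Fintype ι] [DecidableEq ι] {X A : ι → Type*}
    [∀ i, Fintype (X i)] [∀ i, Fintype (A i)]
    (P : (∀ i, X i) → (∀ i, A i) → ℝ) : Prop :=
  ∀ (T : Finset ι) (x x' : ∀ i, X i), (∀ i ∈ T, x i = x' i) →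
    ∀ a₀ : ∀ i, A i,
      ∑ a ∈ univ.filter (fun a : ∀ i, A i => ∀ i ∈ T, a i = a₀ i), P x a =
      ∑ a ∈ univ.filter (fun a : ∀ i, A i => ∀ i ∈ T, a i = a₀ i), P x' a

/-- A box is bilocal if it is a convex combination, over bipartitions `M | Mᶜ` of the
parties and hidden variables, of products of nonsignalling boxes on the two groups. -/
def Bilocal {ι : Type*} [Fintype ι] [DecidableEq ι] {X A : ι → Type*}
    [∀ i, Fintype (X i)] [∀ i, Fintype (A i)]
    (P : (∀ i, X i) → (∀ i, A i) → ℝ) : Prop :=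
  ∃ (L : ℕ) (M : Fin L → Finset ι) (w : Fin L → ℝ)
    (Q : (l : Fin L) →
      (((j : {j : ι // j ∈ M l}) → X j.1) → ((j : {j : ι // j ∈ M l}) → A j.1) → ℝ))
    (R : (l : Fin L) →
      (((j : {j : ι // j ∉ M l}) → X j.1) → ((j : {j : ι // j ∉ M l}) → A j.1) → ℝ)),
    (∀ l, (M l).Nonempty ∧ M l ≠ Finset.univ) ∧
    (∀ l, 0 ≤ w l) ∧ (∑ l, w l = 1) ∧
    (∀ l, IsBoxN (Q l) ∧ NonSignalling (Q l)) ∧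
    (∀ l, IsBoxN (R l) ∧ NonSignalling (R l)) ∧
    ∀ x a, P x a =
      ∑ l, w l * Q l (fun j => x j.1) (fun j => a j.1) * R l (fun j => x j.1) (fun j => a j.1)



lemma chain_real (s t : ℝ) (hs : 0 < s) (ht : 0 < t) :
    ∃ C > 0, ∀ ε > 0, ∃ (N : ℕ) (η : ℝ) (p1 p2 r1 r2 : ℕ → ℝ), 0 ≤ η ∧ (2 * (N : ℝ) + 1) * η ≤ ε ∧
      (∀ k, p1 k ^ 2 + p2 k ^ 2 = 1) ∧ (∀ k, r1 k ^ 2 + r2 k ^ 2 = 1) ∧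
      C ≤ (s * p1 0 * r1 0 + t * p2 0 * r2 0) ^ 2 ∧
      (∀ k < N, s ^ 2 * p1 k ^ 2 + t ^ 2 * p2 k ^ 2 -
        (s * p1 k * r1 (k + 1) + t * p2 k * r2 (k + 1)) ^ 2 ≤ η) ∧
      (∀ k < N, s ^ 2 * r1 (k + 1) ^ 2 + t ^ 2 * r2 (k + 1) ^ 2 -
        (s * p1 (k + 1) * r1 (k + 1) + t * p2 (k + 1) * r2 (k + 1)) ^ 2 ≤ η) ∧
      (s * p1 N * r1 0 + t * p2 N * r2 0) ^ 2 ≤ η := by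
  by_cases hst : s = t
  · subst hst
    refine ⟨s ^ 2, by positivity, fun ε hε => ?_⟩
    obtain ⟨N, hN⟩ := exists_nat_gt (s ^ 2 * Real.pi ^ 2 / ε)
    have hN0 : (0 : ℝ) < N := lt_of_le_of_lt (by positivity) hN
    have hN1 : (1 : ℝ) ≤ N := by
      have : 0 < N := by exact_mod_cast hN0
      exact_mod_cast this
    set θ : ℝ := Real.pi / (2 * N) with hθ
    have hNθ : (N : ℝ) * θ = Real.pi / 2 := by rw [hθ]; field_simp
    have hcos : ∀ k : ℕ, Real.cos (((k + 1 : ℕ) : ℝ) * θ - k * θ) = Real.cos θ := by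
      intro k; congr 1; push_cast; ring
    refine ⟨N, s ^ 2 * θ ^ 2, fun k => Real.cos (k * θ), fun k => Real.sin (k * θ),
      fun k => Real.cos (k * θ), fun k => Real.sin (k * θ), by positivity, ?_, ?_, ?_, ?_, ?_, ?_, ?_⟩
    · have h1 : s ^ 2 * Real.pi ^ 2 ≤ ε * N := by
        rw [div_lt_iff₀ hε] at hN; linarith
      have h2 : (2 * (N : ℝ) + 1) * (s ^ 2 * θ ^ 2) ≤ (4 * N) * (s ^ 2 * θ ^ 2) := by
        apply mul_le_mul_of_nonneg_right _ (by positivity); linarith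
      have h3 : (4 * (N : ℝ)) * (s ^ 2 * θ ^ 2) = s ^ 2 * Real.pi ^ 2 / N := by
        rw [hθ]; field_simp; ring
      rw [h3] at h2
      refine h2.trans ?_
      rw [div_le_iff₀ hN0]; exact h1
    · intro k; exact Real.cos_sq_add_sin_sq _
    · intro k; exact Real.cos_sq_add_sin_sq _
    · simp
    · intro k _
      have h := hcos k
      rw [Real.cos_sub] at h
      have e1 : s * Real.cos (k * θ) * Real.cos ((k + 1 : ℕ) * θ) +
          s * Real.sin (k * θ) * Real.sin ((k + 1 : ℕ) * θ) = s * Real.cos θ := by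
        rw [← h]; ring
      have e2 := Real.cos_sq_add_sin_sq (k * θ)
      have e3 := Real.cos_sq_add_sin_sq θ
      have e4 : Real.sin θ ^ 2 ≤ θ ^ 2 := by
        have := Real.abs_sin_le_abs (x := θ)
        exact sq_le_sq.mpr this
      simp only [e1]
      have : s ^ 2 * Real.cos (k * θ) ^ 2 + s ^ 2 * Real.sin (k * θ) ^ 2 - (s * Real.cos θ) ^ 2
          = s ^ 2 * Real.sin θ ^ 2 := by
        linear_combination s ^ 2 * e2 - s ^ 2 * e3
      rw [this]
      exact mul_le_mul_of_nonneg_left e4 (by positivity)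
    · intro k _
      have e2 := Real.cos_sq_add_sin_sq ((k + 1 : ℕ) * θ)
      have : s ^ 2 * Real.cos ((k + 1 : ℕ) * θ) ^ 2 + s ^ 2 * Real.sin ((k + 1 : ℕ) * θ) ^ 2 -
        (s * Real.cos ((k + 1 : ℕ) * θ) * Real.cos ((k + 1 : ℕ) * θ) +
          s * Real.sin ((k + 1 : ℕ) * θ) * Real.sin ((k + 1 : ℕ) * θ)) ^ 2 = 0 := by
        have : s * Real.cos ((k + 1 : ℕ) * θ) * Real.cos ((k + 1 : ℕ) * θ) +
          s * Real.sin ((k + 1 : ℕ) * θ) * Real.sin ((k + 1 : ℕ) * θ) = s := by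
          linear_combination s * e2
        rw [this]
        linear_combination s ^ 2 * e2
      rw [this]; positivity
    · simp only [hNθ]; simp; positivity
  · have hne : t ^ 2 - s ^ 2 ≠ 0 := by
      intro h
      have : (t - s) * (t + s) = 0 := by linear_combination h
      rcases mul_eq_zero.mp this with h | h
      · exact hst (by linarith)
      · linarith
    have nrm : ∀ a b : ℝ, 0 < a → ∃ c : ℝ, 0 < c ∧ c ^ 2 * (a ^ 2 + b ^ 2) = 1 := by
      intro a b ha
      refine ⟨(Real.sqrt (a ^ 2 + b ^ 2))⁻¹, by positivity, ?_⟩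
      rw [inv_pow, Real.sq_sqrt (by positivity)]
      field_simp
    obtain ⟨c0, hc0, h0⟩ := nrm (4 * t ^ 3) (-3 * s ^ 3) (by positivity)
    obtain ⟨c1, hc1, h1⟩ := nrm (3 * s) (4 * t) (by positivity)
    obtain ⟨c2, hc2, h2⟩ := nrm (3 * s ^ 2) (4 * t ^ 2) (by positivity)
    refine ⟨(12 / 5 * c0 * s * t * (t ^ 2 - s ^ 2)) ^ 2, by positivity, fun ε hε => ?_⟩
    refine ⟨1, 0, fun k => if k = 0 then 3 / 5 else c2 * (3 * s ^ 2),
      fun k => if k = 0 then 4 / 5 else c2 * (4 * t ^ 2),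
      fun k => if k = 0 then c0 * (4 * t ^ 3) else c1 * (3 * s),
      fun k => if k = 0 then c0 * (-3 * s ^ 3) else c1 * (4 * t), le_rfl, by simpa using hε.le,
      ?_, ?_, ?_, ?_, ?_, ?_⟩
    · intro k
      by_cases hk : k = 0
      · simp [hk]; norm_num
      · simp only [hk, if_false]; linear_combination h2
    · intro k
      by_cases hk : k = 0
      · simp only [hk, if_true]; linear_combination h0
      · simp only [hk, if_false]; linear_combination h1
    · apply le_of_eq; simp only [if_true]; ring
    · intro k hk
      obtain rfl : k = 0 := by omega
      apply le_of_eq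
      simp only [if_true, Nat.zero_add, one_ne_zero, if_false]
      linear_combination (-(9 * s ^ 2 + 16 * t ^ 2) / 25) * h1
    · intro k hk
      obtain rfl : k = 0 := by omega
      apply le_of_eq
      simp only [Nat.zero_add, one_ne_zero, if_false]
      linear_combination (-c1 ^ 2 * (9 * s ^ 4 + 16 * t ^ 4)) * h2
    · apply le_of_eq
      simp only [if_true, one_ne_zero, if_false]
      ring


lemma svd_pair {m : Type} [Fintype m] [DecidableEq m] (T : Matrix m m ℂ) (x x' y y' : m → ℂ)
    (h : (x ⬝ᵥ T *ᵥ y) * (x' ⬝ᵥ T *ᵥ y') ≠ (x ⬝ᵥ T *ᵥ y') * (x' ⬝ᵥ T *ᵥ y)) :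
    ∃ (s t : ℝ) (z1 z2 y1 y2 : m → ℂ), 0 < s ∧ 0 < t ∧
      star z1 ⬝ᵥ z1 = 1 ∧ star z2 ⬝ᵥ z2 = 1 ∧ star z1 ⬝ᵥ z2 = 0 ∧
      star y1 ⬝ᵥ y1 = 1 ∧ star y2 ⬝ᵥ y2 = 1 ∧ star y1 ⬝ᵥ y2 = 0 ∧
      T *ᵥ y1 = (s : ℂ) • z1 ∧ T *ᵥ y2 = (t : ℂ) • z2 ∧
      star z1 ᵥ* T = (s : ℂ) • star y1 ∧ star z2 ᵥ* T = (t : ℂ) • star y2 := by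
  have hP : (Tᴴ * T).PosSemidef := Matrix.posSemidef_conjTranspose_mul_self T
  have hA := hP.1
  set b := hA.eigenvectorBasis with hb
  set e := hA.eigenvalues with he
  have he0 : ∀ j, 0 ≤ e j := hP.eigenvalues_nonneg
  have hbe : ∀ j, (Tᴴ * T) *ᵥ (b j).ofLp = (e j : ℂ) • (b j).ofLp := by
    intro j
    have := hA.mulVec_eigenvectorBasis j
    rw [this]; ext i; simp [he]; exact Or.inl rfl
  have horth : ∀ i j, star (b i).ofLp ⬝ᵥ (b j).ofLp = if i = j then 1 else 0 := by
    intro i j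
    have := orthonormal_iff_ite.mp b.orthonormal i j
    rw [EuclideanSpace.inner_eq_star_dotProduct, dotProduct_comm] at this
    exact this
  have key : ∃ i j, i ≠ j ∧ e i ≠ 0 ∧ e j ≠ 0 := by
    by_contra hcon
    push Not at hcon
    have hz : ∀ j, e j = 0 → T *ᵥ (b j).ofLp = 0 := by
      intro j hj
      have := hbe j
      rw [hj] at this
      simp only [Complex.ofReal_zero, zero_smul] at this
      exact (Matrix.conjTranspose_mul_self_mulVec_eq_zero T _).mp this
    have hexp : ∀ v : m → ℂ, v = ∑ j, (b.repr (WithLp.toLp 2 v) j) • (b j).ofLp := by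
      intro v
      have := congrArg WithLp.ofLp (b.sum_repr (WithLp.toLp 2 v))
      simpa using this.symm
    have hT : ∀ v : m → ℂ, T *ᵥ v = ∑ j, (b.repr (WithLp.toLp 2 v) j) • T *ᵥ (b j).ofLp := by
      intro v
      conv_lhs => rw [hexp v]
      rw [Matrix.mulVec_sum]
      simp only [Matrix.mulVec_smul]
    by_cases hall : ∀ j, e j = 0
    · have : ∀ v, T *ᵥ v = 0 := by
        intro v; rw [hT]; apply Finset.sum_eq_zero; intro j _; rw [hz j (hall j), smul_zero]
      apply h; simp [this]
    · push Not at hall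
      obtain ⟨i, hi⟩ := hall
      have : ∀ v, T *ᵥ v = (b.repr (WithLp.toLp 2 v) i) • T *ᵥ (b i).ofLp := by
        intro v; rw [hT]; apply Finset.sum_eq_single_of_mem _ (Finset.mem_univ _)
        intro j _ hji
        rw [hz j (hcon i j hji.symm hi), smul_zero]
      apply h
      rw [this y, this y']
      simp only [dotProduct_smul, smul_eq_mul]
      ring
  obtain ⟨i, j, hij, hi, hj⟩ := key
  have mk : ∀ k, e k ≠ 0 → 0 < Real.sqrt (e k) := fun k hk =>
    Real.sqrt_pos.mpr (lt_of_le_of_ne (he0 k) hk.symm)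
  have hsq : ∀ k, ((Real.sqrt (e k) : ℝ) : ℂ) * (Real.sqrt (e k) : ℝ) = e k := by
    intro k; rw [← Complex.ofReal_mul, Real.mul_self_sqrt (he0 k)]
  have zdot : ∀ k l, star (T *ᵥ (b k).ofLp) ⬝ᵥ (T *ᵥ (b l).ofLp) = e l * if k = l then 1 else 0 := by
    intro k l
    rw [Matrix.star_mulVec, ← Matrix.dotProduct_mulVec, Matrix.mulVec_mulVec, hbe, dotProduct_smul,
      horth, smul_eq_mul]
  have zT : ∀ k, star (T *ᵥ (b k).ofLp) ᵥ* T = (e k : ℂ) • star (b k).ofLp := by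
    intro k
    have := congrArg star (hbe k)
    rw [Matrix.star_mulVec, hA.eq, ← Matrix.vecMul_vecMul, ← Matrix.star_mulVec] at this
    rw [this, star_smul]; simp
  have ssne : ∀ k, e k ≠ 0 → ((Real.sqrt (e k) : ℝ) : ℂ) ≠ 0 := fun k hk => by
    exact_mod_cast (mk k hk).ne'
  refine ⟨Real.sqrt (e i), Real.sqrt (e j), ((Real.sqrt (e i) : ℝ) : ℂ)⁻¹ • T *ᵥ (b i).ofLp,
    ((Real.sqrt (e j) : ℝ) : ℂ)⁻¹ • T *ᵥ (b j).ofLp, (b i).ofLp, (b j).ofLp, mk i hi, mk j hj,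
    ?_, ?_, ?_, ?_, ?_, ?_, ?_, ?_, ?_, ?_⟩
  · rw [star_smul, smul_dotProduct, dotProduct_smul, zdot]
    have := ssne i hi; have h2 := hsq i
    simp
    rw [← h2]; field_simp
  · rw [star_smul, smul_dotProduct, dotProduct_smul, zdot]
    have := ssne j hj; have h2 := hsq j
    simp
    rw [← h2]; field_simp
  · rw [star_smul, smul_dotProduct, dotProduct_smul, zdot]
    simp [hij]
  · rw [horth]; simp
  · rw [horth]; simp
  · rw [horth]; simp [hij]
  · rw [smul_inv_smul₀ (ssne i hi)]
  · rw [smul_inv_smul₀ (ssne j hj)]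
  · rw [star_smul, Matrix.smul_vecMul, zT, ← hsq i, smul_smul]
    congr 1
    have := ssne i hi
    simp; field_simp
  · rw [star_smul, Matrix.smul_vecMul, zT, ← hsq j, smul_smul]
    congr 1
    have := ssne j hj
    simp; field_simp

lemma orth_norm {m : Type} [Fintype m] (y1 y2 : m → ℂ) (h1 : star y1 ⬝ᵥ y1 = 1)
    (h2 : star y2 ⬝ᵥ y2 = 1) (h12 : star y1 ⬝ᵥ y2 = 0) (a b a' b' : ℝ) :
    star ((a : ℂ) • y1 + (b : ℂ) • y2) ⬝ᵥ ((a' : ℂ) • y1 + (b' : ℂ) • y2) =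
      ((a * a' + b * b' : ℝ) : ℂ) := by
  have h21 : star y2 ⬝ᵥ y1 = 0 := by
    have := congrArg star h12
    rw [Matrix.star_dotProduct] at this
    simpa [dotProduct_comm] using this
  simp only [star_add, star_smul, add_dotProduct, dotProduct_add, smul_dotProduct, dotProduct_smul,
    h1, h2, h12, h21, smul_eq_mul]
  simp
  ring

lemma sum_norm_eq {m : Type} [Fintype m] (v : m → ℂ) (r : ℝ) (h : star v ⬝ᵥ v = (r : ℂ)) :
    ∑ b, ‖v b‖ ^ 2 = r := by
  have : ((∑ b, ‖v b‖ ^ 2 : ℝ) : ℂ) = r := by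
    rw [← h, dotProduct]
    push_cast
    apply Finset.sum_congr rfl
    intro b _
    simp [← Complex.conj_mul']
  exact_mod_cast this

lemma edge_matrix {m : Type} [Fintype m] [DecidableEq m] (T : Matrix m m ℂ) (x x' y y' : m → ℂ)
    (h : (x ⬝ᵥ T *ᵥ y) * (x' ⬝ᵥ T *ᵥ y') ≠ (x ⬝ᵥ T *ᵥ y') * (x' ⬝ᵥ T *ᵥ y)) :
    ∃ C > (0 : ℝ), ∀ ε > (0 : ℝ), ∃ (N : ℕ) (η : ℝ) (u v : ℕ → m → ℂ),
      0 ≤ η ∧ (2 * (N : ℝ) + 1) * η ≤ ε ∧ (∀ k, UnitVec (u k)) ∧ (∀ k, UnitVec (v k)) ∧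
      C ≤ ‖u 0 ⬝ᵥ T *ᵥ v 0‖ ^ 2 ∧
      (∀ k < N, ∑ b, ‖u k ⬝ᵥ T *ᵥ Pi.single b 1‖ ^ 2 - ‖u k ⬝ᵥ T *ᵥ v (k + 1)‖ ^ 2 ≤ η) ∧
      (∀ k < N, ∑ a, ‖Pi.single a 1 ⬝ᵥ T *ᵥ v (k + 1)‖ ^ 2
        - ‖u (k + 1) ⬝ᵥ T *ᵥ v (k + 1)‖ ^ 2 ≤ η) ∧
      ‖u N ⬝ᵥ T *ᵥ v 0‖ ^ 2 ≤ η := by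
  obtain ⟨s, t, z1, z2, y1, y2, hs, ht, hz1, hz2, hz12, hy1, hy2, hy12, T1, T2, T3, T4⟩ :=
    svd_pair T x x' y y' h
  obtain ⟨C, hC, H⟩ := chain_real s t hs ht
  refine ⟨C, hC, fun ε hε => ?_⟩
  obtain ⟨N, η, p1, p2, r1, r2, h1, h2, h3, h4, h5, h6, h7, h8⟩ := H ε hε
  set u : ℕ → m → ℂ := fun k => star ((p1 k : ℂ) • z1 + (p2 k : ℂ) • z2) with hu
  set v : ℕ → m → ℂ := fun k => (r1 k : ℂ) • y1 + (r2 k : ℂ) • y2 with hv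
  have hTv : ∀ k, T *ᵥ v k = ((r1 k * s : ℝ) : ℂ) • z1 + ((r2 k * t : ℝ) : ℂ) • z2 := by
    intro k
    simp only [hv, Matrix.mulVec_add, Matrix.mulVec_smul, T1, T2, smul_smul]
    push_cast; rfl
  have huT : ∀ k, u k ᵥ* T = star (((p1 k * s : ℝ) : ℂ) • y1 + ((p2 k * t : ℝ) : ℂ) • y2) := by
    intro k
    simp only [hu, star_add, star_smul, Matrix.add_vecMul, Matrix.smul_vecMul, T3, T4, smul_smul]
    simp
  have hB : ∀ k l, ‖u k ⬝ᵥ T *ᵥ v l‖ ^ 2 = (s * p1 k * r1 l + t * p2 k * r2 l) ^ 2 := by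
    intro k l
    rw [hTv, hu, orth_norm z1 z2 hz1 hz2 hz12, Complex.norm_real, Real.norm_eq_abs, sq_abs]
    ring
  have hU : ∀ k, ∑ b, ‖u k ⬝ᵥ T *ᵥ Pi.single b 1‖ ^ 2 = s ^ 2 * p1 k ^ 2 + t ^ 2 * p2 k ^ 2 := by
    intro k
    have := sum_norm_eq _ _ (orth_norm y1 y2 hy1 hy2 hy12 (p1 k * s) (p2 k * t) (p1 k * s) (p2 k * t))
    rw [show s ^ 2 * p1 k ^ 2 + t ^ 2 * p2 k ^ 2 =
      p1 k * s * (p1 k * s) + p2 k * t * (p2 k * t) by ring, ← this]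
    apply Finset.sum_congr rfl
    intro b _
    rw [Matrix.dotProduct_mulVec, huT, dotProduct_single_one, Pi.star_apply, norm_star]
  have hV : ∀ k, ∑ a, ‖Pi.single a 1 ⬝ᵥ T *ᵥ v k‖ ^ 2 = s ^ 2 * r1 k ^ 2 + t ^ 2 * r2 k ^ 2 := by
    intro k
    have := sum_norm_eq _ _ (orth_norm z1 z2 hz1 hz2 hz12 (r1 k * s) (r2 k * t) (r1 k * s) (r2 k * t))
    rw [show s ^ 2 * r1 k ^ 2 + t ^ 2 * r2 k ^ 2 =
      r1 k * s * (r1 k * s) + r2 k * t * (r2 k * t) by ring, ← this]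
    apply Finset.sum_congr rfl
    intro b _
    rw [hTv, single_one_dotProduct]
  refine ⟨N, η, u, v, h1, h2, ?_, ?_, ?_, ?_, ?_, ?_⟩
  · intro k
    have := orth_norm z1 z2 hz1 hz2 hz12 (p1 k) (p2 k) (p1 k) (p2 k)
    rw [← sq, ← sq, h3, dotProduct_comm] at this
    simpa [UnitVec, hu, dotProduct] using this
  · intro k
    have := orth_norm y1 y2 hy1 hy2 hy12 (r1 k) (r2 k) (r1 k) (r2 k)
    rw [← sq, ← sq, h4] at this
    simpa [UnitVec, hv, dotProduct] using this
  · rw [hB]; exact h5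
  · intro k hk; rw [hU, hB]; exact h6 k hk
  · intro k hk; rw [hV, hB]; exact h7 k hk
  · rw [hB]; exact h8


/-- The amplitude of `Ψ` against a product of local vectors, as a multilinear map. -/
def amp {n d : ℕ} (Ψ : (Fin n → Fin d) → ℂ) :
    MultilinearMap ℂ (fun _ : Fin n => Fin d → ℂ) ℂ :=
  ∑ h : Fin n → Fin d, Ψ h • (MultilinearMap.mkPiAlgebra ℂ (Fin n) ℂ).compLinearMap
    (fun k => LinearMap.proj (R := ℂ) (φ := fun _ : Fin d => ℂ) (h k))

lemma amp_apply {n d : ℕ} (Ψ : (Fin n → Fin d) → ℂ) (v : Fin n → Fin d → ℂ) :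
    amp Ψ v = ∑ h : Fin n → Fin d, (∏ k, v k (h k)) * Ψ h := by
  simp [amp, mul_comm]

lemma amp_basis {n d : ℕ} (Ψ : (Fin n → Fin d) → ℂ) (g : Fin n → Fin d) :
    amp Ψ (fun k => Pi.single (g k) 1) = Ψ g := by
  rw [amp_apply, Finset.sum_eq_single g]
  · simp
  · intro h _ hne
    obtain ⟨k, hk⟩ := Function.ne_iff.mp hne
    rw [Finset.prod_eq_zero (Finset.mem_univ k), zero_mul]
    simp [hk]
  · simp

/-- No entanglement between `S` and `S'`, after contraction with product vectors. -/
def NoEnt {n : ℕ} {V : Type} [AddCommGroup V] [Module ℂ V]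
    (f : MultilinearMap ℂ (fun _ : Fin n => V) ℂ) (S S' : Finset (Fin n)) : Prop :=
  ∀ u p : Fin n → V, f u * f ((S ∪ S').piecewise p u) = f (S.piecewise p u) * f (S'.piecewise p u)

lemma NoEnt.symm {n : ℕ} {V : Type} [AddCommGroup V] [Module ℂ V]
    {f : MultilinearMap ℂ (fun _ : Fin n => V) ℂ} {S S' : Finset (Fin n)} (h : NoEnt f S S') :
    NoEnt f S' S := by
  intro u p
  rw [Finset.union_comm, h u p, mul_comm]

lemma lin2 {V : Type} [AddCommGroup V] [Module ℂ V] (f g : V →ₗ[ℂ] ℂ)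
    (h : ∀ v, f v * g v = 0) : (∀ v, f v = 0) ∨ (∀ v, g v = 0) := by
  by_contra hcon
  push Not at hcon
  obtain ⟨⟨a, ha⟩, ⟨b, hb⟩⟩ := hcon
  have h1 := h a
  have h2 := h b
  have h3 := h (a + b)
  have ga : g a = 0 := by simpa [ha] using h1
  have fb : f b = 0 := by simpa [hb] using h2
  simp [ga, fb, ha, hb] at h3

lemma lin3 {V : Type} [AddCommGroup V] [Module ℂ V] (f g k : V →ₗ[ℂ] ℂ)
    (h : ∀ v, f v * g v * k v = 0) : (∀ v, f v = 0) ∨ (∀ v, g v = 0) ∨ (∀ v, k v = 0) := by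
  by_contra hcon
  push Not at hcon
  obtain ⟨⟨a, ha⟩, ⟨b, hb⟩, ⟨c, hc⟩⟩ := hcon
  obtain ⟨v, hv⟩ := Module.Dual.exists_forall_ne_zero_of_forall_exists (K := ℂ) (M := V)
    ![f, g, k] (by
      intro i; fin_cases i
      · exact ⟨a, ha⟩
      · exact ⟨b, hb⟩
      · exact ⟨c, hc⟩)
  have h0 := hv 0
  have h1 := hv 1
  have h2 := hv 2
  exact mul_ne_zero (mul_ne_zero h0 h1) h2 (h v)

lemma NoEnt.insert {n : ℕ} {V : Type} [AddCommGroup V] [Module ℂ V]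
    {f : MultilinearMap ℂ (fun _ : Fin n => V) ℂ} {S S' : Finset (Fin n)} {i : Fin n}
    (hiS : i ∉ S) (hiS' : i ∉ S') (h1 : NoEnt f {i} S') (h2 : NoEnt f S S') :
    NoEnt f (insert i S) S' := by
  intro u p
  -- the linear functionals in the `i`-th variable
  set a : V → (Fin n → V) := fun x => Function.update u i x with ha
  have e1 : ∀ R : Finset (Fin n), i ∉ R → ∀ x,
      R.piecewise p (Function.update u i x) = Function.update (R.piecewise p u) i x := by
    intro R hR x
    ext k
    by_cases hk : k = i
    · subst hk; simp [hR]
    · by_cases hkR : k ∈ R <;> simp [hk, hkR]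
  have e2 : ∀ R : Finset (Fin n), i ∉ R → ∀ x,
      (Insert.insert i R).piecewise (Function.update p i x) u = Function.update (R.piecewise p u) i x := by
    intro R hR x
    ext k
    by_cases hk : k = i
    · subst hk; simp
    · by_cases hkR : k ∈ R <;> simp [hk, hkR]
  have e3 : ∀ R : Finset (Fin n), i ∉ R → ∀ x,
      R.piecewise (Function.update p i x) u = R.piecewise p u := by
    intro R hR x
    ext k
    by_cases hkR : k ∈ R
    · have : k ≠ i := fun h => hR (h ▸ hkR)
      simp [hkR, this]
    · simp [hkR]
  have e4 : ∀ R : Finset (Fin n), i ∉ R → Function.update (R.piecewise p u) i (u i) = R.piecewise p u := by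
    intro R hR
    have : (R.piecewise p u) i = u i := by simp [hR]
    rw [← this, Function.update_eq_self]
  have hiSS : i ∉ S ∪ S' := by simp [hiS, hiS']
  let L := f.toLinearMap u i
  let LS := f.toLinearMap (S.piecewise p u) i
  let LS' := f.toLinearMap (S'.piecewise p u) i
  let LSS := f.toLinearMap ((S ∪ S').piecewise p u) i
  have A1 : ∀ x, f u * LS' x = L x * f (S'.piecewise p u) := by
    intro x
    have := h1 u (Function.update p i x)
    rw [← Finset.insert_eq, e2 S' hiS', e3 S' hiS', ← Finset.insert_empty (a := i), e2 ∅ (by simp), Finset.piecewise_empty] at this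
    exact this
  have A2 : ∀ x, L x * LSS x = LS x * LS' x := by
    intro x
    have := h2 (Function.update u i x) p
    rw [e1 _ hiSS, e1 _ hiS, e1 _ hiS'] at this
    exact this
  have goal' : ∀ x, f u * LSS x = LS x * f (S'.piecewise p u) := by
    have hl : ∀ x, (f u • LSS - f (S'.piecewise p u) • LS) x * L x * LS' x = 0 := by
      intro x
      simp only [LinearMap.sub_apply, LinearMap.smul_apply, smul_eq_mul]
      linear_combination (LSS x * L x) * A1 x + (L x * f (S'.piecewise p u)) * A2 x
    have Lu : L (u i) = f u := by simp [L]
    have LSu' : LS' (u i) = f (S'.piecewise p u) := by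
      simp only [LS', MultilinearMap.toLinearMap_apply, e4 S' hiS']
    rcases lin3 _ _ _ hl with h | h | h
    · intro x
      have := h x
      simp only [LinearMap.sub_apply, LinearMap.smul_apply, smul_eq_mul] at this
      linear_combination this
    · have fu : f u = 0 := by rw [← Lu, h]
      have : ∀ x, LS x * LS' x = 0 := by intro x; rw [← A2, h]; ring
      rcases lin2 _ _ this with h' | h'
      · intro x; rw [h', fu]; ring
      · intro x; rw [fu, ← LSu', h']; ring
    · have fu : f (S'.piecewise p u) = 0 := by rw [← LSu', h]
      have : ∀ x, L x * LSS x = 0 := by intro x; rw [A2, h]; ring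
      rcases lin2 _ _ this with h' | h'
      · intro x; rw [← Lu, h', fu]; ring
      · intro x; rw [h', fu]; ring
  have := goal' (p i)
  have hp : Function.update p i (p i) = p := Function.update_eq_self _ _
  rw [Finset.insert_union]
  have e2' : ∀ R : Finset (Fin n), i ∉ R →
      (Insert.insert i R).piecewise p u = Function.update (R.piecewise p u) i (p i) := by
    intro R hR
    have := e2 R hR (p i)
    rwa [hp] at this
  rw [e2' _ hiSS, e2' _ hiS]
  exact this

lemma NoEnt.of_pairs {n : ℕ} {V : Type} [AddCommGroup V] [Module ℂ V]
    {f : MultilinearMap ℂ (fun _ : Fin n => V) ℂ} (S S' : Finset (Fin n)) (hd : Disjoint S S')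
    (h : ∀ i ∈ S, ∀ j ∈ S', NoEnt f {i} {j}) : NoEnt f S S' := by
  have empt : ∀ R, NoEnt f ∅ R := by intro R u p; rw [Finset.empty_union]; simp
  have step : ∀ (R : Finset (Fin n)) (S : Finset (Fin n)), Disjoint S R →
      (∀ i ∈ S, NoEnt f {i} R) → NoEnt f S R := by
    intro R S
    induction S using Finset.induction_on with
    | empty => intro _ _; exact empt R
    | insert i S hi ih =>
      intro hd hh
      rw [Finset.disjoint_insert_left] at hd
      exact NoEnt.insert hi hd.1 (hh i (by simp)) (ih hd.2 (fun k hk => hh k (by simp [hk])))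
  apply step S' S hd
  intro i hi
  apply NoEnt.symm
  apply step {i} S'
  · rw [Finset.disjoint_singleton_right]; exact Finset.disjoint_left.mp hd hi
  · intro j hj; exact (h i hi j hj).symm

lemma cut_lemma {n d : ℕ} (Ψ : (Fin n → Fin d) → ℂ) (hne : ∃ g, Ψ g ≠ 0)
    (hGME : ¬ IsBisepVec (Idx := fun _ : Fin n => Fin d) Ψ)
    (M : Finset (Fin n)) (hM : M.Nonempty) (hM' : M ≠ Finset.univ) :
    ∃ i ∈ M, ∃ j, j ∉ M ∧ ¬ NoEnt (amp Ψ) {i} {j} := by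
  by_contra hcon
  push Not at hcon
  have hN : NoEnt (amp Ψ) M Mᶜ := by
    apply NoEnt.of_pairs _ _ disjoint_compl_right
    intro i hi j hj
    exact hcon i hi j (by simpa using hj)
  obtain ⟨g, hg⟩ := hne
  apply hGME
  have key : ∀ f, Ψ g * Ψ f = Ψ (M.piecewise f g) * Ψ (Mᶜ.piecewise f g) := by
    intro f
    have := hN (fun k => Pi.single (g k) 1) (fun k => Pi.single (f k) 1)
    have aux : ∀ R : Finset (Fin n), R.piecewise (fun k => (Pi.single (f k) 1 : Fin d → ℂ))
        (fun k => Pi.single (g k) 1) = fun k => Pi.single (R.piecewise f g k) 1 := by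
      intro R; ext k : 1
      by_cases hk : k ∈ R <;> simp [hk]
    rw [aux, aux, aux, amp_basis, amp_basis, amp_basis, amp_basis, Finset.union_compl] at this
    simpa using this
  refine ⟨M, hM, hM', fun a => Ψ (fun k => if hk : k ∈ M then a ⟨k, hk⟩ else g k),
    fun b => (Ψ g)⁻¹ * Ψ (fun k => if hk : k ∉ M then b ⟨k, hk⟩ else g k), ?_⟩
  intro f
  have e1 : (fun k => if k ∈ M then f k else g k) = M.piecewise f g := by
    ext k; by_cases hk : k ∈ M <;> simp [hk]
  have e2 : (fun k => if k ∉ M then f k else g k) = Mᶜ.piecewise f g := by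
    ext k; by_cases hk : k ∈ M <;> simp [hk]
  simp only [dite_eq_ite]
  rw [e1, e2]
  have := key f
  field_simp
  linear_combination this


lemma exists_unit_smul {d : ℕ} (v : Fin d → ℂ) (hv : v ≠ 0) :
    ∃ c : ℂ, c ≠ 0 ∧ UnitVec (c • v) := by
  have hpos : 0 < ∑ b, ‖v b‖ ^ 2 := by
    obtain ⟨b, hb⟩ := Function.ne_iff.mp hv
    apply Finset.sum_pos' (fun _ _ => by positivity)
    refine ⟨b, Finset.mem_univ _, ?_⟩
    have : v b ≠ 0 := hb
    positivity
  set r := ∑ b, ‖v b‖ ^ 2 with hr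
  have hs : 0 < Real.sqrt r := Real.sqrt_pos.mpr hpos
  refine ⟨((Real.sqrt r)⁻¹ : ℝ), by exact_mod_cast (inv_pos.mpr hs).ne', ?_⟩
  unfold UnitVec
  have : ∀ i, star ((((Real.sqrt r)⁻¹ : ℝ) : ℂ) • v) i * ((((Real.sqrt r)⁻¹ : ℝ) : ℂ) • v) i
      = ((r⁻¹ * ‖v i‖ ^ 2 : ℝ) : ℂ) := by
    intro i
    simp only [Pi.star_apply, Pi.smul_apply, smul_eq_mul, star_mul']
    have h1 : star (v i) * v i = ((‖v i‖ ^ 2 : ℝ) : ℂ) := by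
      have := Complex.conj_mul' (v i)
      push_cast; exact this
    have h2 : star (((Real.sqrt r)⁻¹ : ℝ) : ℂ) = (((Real.sqrt r)⁻¹ : ℝ) : ℂ) := Complex.conj_ofReal _
    rw [h2]
    have h3 : (((Real.sqrt r)⁻¹ : ℝ) : ℂ) * (((Real.sqrt r)⁻¹ : ℝ) : ℂ) = ((r⁻¹ : ℝ) : ℂ) := by
      rw [← Complex.ofReal_mul, ← mul_inv, Real.mul_self_sqrt hpos.le]
    rw [Complex.ofReal_mul, ← h1, ← h3]; ring
  have h5 : ∀ i, star (((((Real.sqrt r)⁻¹ : ℝ) : ℂ) • v) i) * ((((Real.sqrt r)⁻¹ : ℝ) : ℂ) • v) i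
      = ((r⁻¹ * ‖v i‖ ^ 2 : ℝ) : ℂ) := this
  rw [Finset.sum_congr rfl (fun i _ => h5 i), ← Complex.ofReal_sum, ← Finset.mul_sum, ← hr,
    inv_mul_cancel₀ hpos.ne']
  simp

/-- Contraction of `Ψ` leaving free the parties `i` and `j`. -/
def amp2 {n d : ℕ} (Ψ : (Fin n → Fin d) → ℂ) (w : Fin n → Fin d → ℂ) (i j : Fin n)
    (x y : Fin d → ℂ) : ℂ := amp Ψ (Function.update (Function.update w i x) j y)

lemma pair_of_not_noEnt {n d : ℕ} (Ψ : (Fin n → Fin d) → ℂ) (i j : Fin n) (hij : i ≠ j)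
    (h : ¬ NoEnt (amp Ψ) {i} {j}) :
    ∃ (w : Fin n → Fin d → ℂ) (x x' y y' : Fin d → ℂ),
      (∀ k, k ≠ i → k ≠ j → UnitVec (w k)) ∧
      amp2 Ψ w i j x y * amp2 Ψ w i j x' y' ≠ amp2 Ψ w i j x y' * amp2 Ψ w i j x' y := by
  unfold NoEnt at h
  push Not at h
  obtain ⟨u, p, h⟩ := h
  have q0 : u = Function.update (Function.update u i (u i)) j (u j) := by simp
  have q1 : ({i} ∪ {j} : Finset (Fin n)).piecewise p u =
      Function.update (Function.update u i (p i)) j (p j) := by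
    ext k : 1
    by_cases hk : k = j
    · subst hk; simp [Finset.piecewise]
    · by_cases hk' : k = i
      · subst hk'; simp [Finset.piecewise, hk]
      · simp [Finset.piecewise, hk, hk']
  have q2 : ({i} : Finset (Fin n)).piecewise p u =
      Function.update (Function.update u i (p i)) j (u j) := by
    ext k : 1
    by_cases hk : k = j
    · subst hk; simp [hij.symm]
    · by_cases hk' : k = i
      · subst hk'; simp [hk]
      · simp [hk, hk']
  have q3 : ({j} : Finset (Fin n)).piecewise p u =
      Function.update (Function.update u i (u i)) j (p j) := by
    ext k : 1
    by_cases hk : k = j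
    · subst hk; simp
    · by_cases hk' : k = i
      · subst hk'; simp [hk]
      · simp [hk, hk']
  rw [q1, q2, q3] at h
  have h' : amp2 Ψ u i j (u i) (u j) * amp2 Ψ u i j (p i) (p j) ≠
      amp2 Ψ u i j (u i) (p j) * amp2 Ψ u i j (p i) (u j) := by
    unfold amp2
    rw [← q0, mul_comm (amp Ψ (Function.update (Function.update u i (u i)) j (p j)))]
    exact h
  have hne : ∀ k, k ≠ i → k ≠ j → u k ≠ 0 := by
    intro k hki hkj hk
    apply h'
    have : ∀ x y, amp2 Ψ u i j x y = 0 := by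
      intro x y
      apply MultilinearMap.map_coord_zero _ k
      simp [hki, hkj, hk]
    simp [this]
  have hc : ∀ k, ∃ c : ℂ, c ≠ 0 ∧ (k ≠ i → k ≠ j → UnitVec (c • u k)) ∧ ((k = i ∨ k = j) → c = 1) := by
    intro k
    by_cases hk : k = i ∨ k = j
    · exact ⟨1, one_ne_zero, fun h1 h2 => by tauto, fun _ => rfl⟩
    · push Not at hk
      obtain ⟨c, hc, hu⟩ := exists_unit_smul (u k) (hne k hk.1 hk.2)
      exact ⟨c, hc, fun _ _ => hu, fun h => by tauto⟩
  choose c hc0 hcu hc1 using hc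
  refine ⟨fun k => c k • u k, u i, p i, u j, p j, hcu, ?_⟩
  have hs : ∀ x y, amp2 Ψ (fun k => c k • u k) i j x y = (∏ k, c k) * amp2 Ψ u i j x y := by
    intro x y
    unfold amp2
    rw [← smul_eq_mul, ← MultilinearMap.map_smul_univ]
    congr 1
    ext k : 1
    by_cases hk : k = j
    · subst hk; simp [hc1 k (Or.inr rfl)]
    · by_cases hk' : k = i
      · subst hk'; simp [hk, hc1 k (Or.inl rfl)]
      · simp [hk, hk']
  have hK : (∏ k, c k) ≠ 0 := Finset.prod_ne_zero_iff.mpr fun k _ => hc0 k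
  simp only [hs]
  intro hh
  apply h'
  have : (∏ k, c k) ^ 2 * (amp2 Ψ u i j (u i) (u j) * amp2 Ψ u i j (p i) (p j)) =
      (∏ k, c k) ^ 2 * (amp2 Ψ u i j (u i) (p j) * amp2 Ψ u i j (p i) (u j)) := by
    linear_combination hh
  exact mul_left_cancel₀ (pow_ne_zero 2 hK) this

lemma amp2_bilin {n d : ℕ} (Ψ : (Fin n → Fin d) → ℂ) (w : Fin n → Fin d → ℂ) (i j : Fin n)
    (hij : i ≠ j) (x y : Fin d → ℂ) :
    amp2 Ψ w i j x y =
      x ⬝ᵥ (Matrix.of fun a b => amp2 Ψ w i j (Pi.single a 1) (Pi.single b 1)) *ᵥ y := by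
  have hy : ∀ x, amp2 Ψ w i j x y = ∑ b, y b * amp2 Ψ w i j x (Pi.single b 1) := by
    intro x
    have := LinearMap.pi_apply_eq_sum_univ ((amp Ψ).toLinearMap (Function.update w i x) j) y
    simp only [MultilinearMap.toLinearMap_apply, smul_eq_mul] at this
    unfold amp2
    rw [this]
    apply Finset.sum_congr rfl
    intro b _
    congr 4
    ext b'; simp [Pi.single_apply, eq_comm]
  have hx : ∀ z, amp2 Ψ w i j x z = ∑ a, x a * amp2 Ψ w i j (Pi.single a 1) z := by
    intro z
    have := LinearMap.pi_apply_eq_sum_univ ((amp Ψ).toLinearMap (Function.update w j z) i) x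
    simp only [MultilinearMap.toLinearMap_apply, smul_eq_mul] at this
    unfold amp2
    simp only [Function.update_comm hij]
    rw [this]
    apply Finset.sum_congr rfl
    intro b _
    congr 4
    ext b'; simp [Pi.single_apply, eq_comm]
  rw [hx]
  simp only [dotProduct, Matrix.mulVec, Matrix.of_apply]
  apply Finset.sum_congr rfl
  intro a _
  rw [hy]
  congr 1
  apply Finset.sum_congr rfl
  intro b _
  ring

lemma edge_data {n d : ℕ} (Ψ : (Fin n → Fin d) → ℂ) (i j : Fin n) (hij : i ≠ j)
    (h : ¬ NoEnt (amp Ψ) {i} {j}) :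
    ∃ C > (0 : ℝ), ∀ ε > (0 : ℝ), ∃ (N : ℕ) (η : ℝ) (w : Fin n → Fin d → ℂ) (u v : ℕ → Fin d → ℂ),
      0 ≤ η ∧ (2 * (N : ℝ) + 1) * η ≤ ε ∧ (∀ k, k ≠ i → k ≠ j → UnitVec (w k)) ∧
      (∀ k, UnitVec (u k)) ∧ (∀ k, UnitVec (v k)) ∧
      C ≤ ‖amp2 Ψ w i j (u 0) (v 0)‖ ^ 2 ∧
      (∀ k < N, ∑ b, ‖amp2 Ψ w i j (u k) (Pi.single b 1)‖ ^ 2 -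
        ‖amp2 Ψ w i j (u k) (v (k + 1))‖ ^ 2 ≤ η) ∧
      (∀ k < N, ∑ a, ‖amp2 Ψ w i j (Pi.single a 1) (v (k + 1))‖ ^ 2
        - ‖amp2 Ψ w i j (u (k + 1)) (v (k + 1))‖ ^ 2 ≤ η) ∧
      ‖amp2 Ψ w i j (u N) (v 0)‖ ^ 2 ≤ η := by
  obtain ⟨w, x, x', y, y', hw, hne⟩ := pair_of_not_noEnt Ψ i j hij h
  simp only [amp2_bilin Ψ w i j hij x, amp2_bilin Ψ w i j hij x'] at hne
  obtain ⟨C, hC, H⟩ := edge_matrix _ x x' y y' hne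
  refine ⟨C, hC, fun ε hε => ?_⟩
  obtain ⟨N, η, u, v, h1, h2, h3, h4, h5, h6, h7, h8⟩ := H ε hε
  refine ⟨N, η, w, u, v, h1, h2, hw, h3, h4, ?_, ?_, ?_, ?_⟩
  · rw [amp2_bilin Ψ w i j hij]; exact h5
  · intro k hk
    have := h6 k hk
    simp only [← amp2_bilin Ψ w i j hij] at this
    exact this
  · intro k hk
    have := h7 k hk
    simp only [← amp2_bilin Ψ w i j hij] at this
    exact this
  · rw [amp2_bilin Ψ w i j hij]; exact h8


/-- Tensor product of matrices. -/
def tens {ι D : Type} [Fintype ι] (A : ι → Matrix D D ℂ) : Matrix (ι → D) (ι → D) ℂ :=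
  Matrix.of fun g g' => ∏ i, A i (g i) (g' i)

/-- Orthogonal projections. -/
def IsPr {D : Type} [Fintype D] (A : Matrix D D ℂ) : Prop := Aᴴ = A ∧ A * A = A

lemma prod_sum_fun {ι D : Type} [Fintype ι] [DecidableEq ι] [Fintype D] (f : ι → D → ℂ) :
    ∏ i, ∑ b, f i b = ∑ g : ι → D, ∏ i, f i (g i) := by
  rw [Finset.prod_univ_sum, Fintype.piFinset_univ]

lemma tens_isPr {ι D : Type} [Fintype ι] [DecidableEq ι] [Fintype D] (A : ι → Matrix D D ℂ)
    (h : ∀ i, IsPr (A i)) : IsPr (tens A) := by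
  constructor
  · ext g g'
    simp only [tens, Matrix.conjTranspose_apply, Matrix.of_apply]
    rw [star_prod]
    apply Finset.prod_congr rfl
    intro i _
    rw [← Matrix.conjTranspose_apply, (h i).1]
  · ext g g'
    simp only [tens, Matrix.mul_apply, Matrix.of_apply]
    simp only [← Finset.prod_mul_distrib]
    rw [← prod_sum_fun (fun i b => A i (g i) b * A i b (g' i))]
    apply Finset.prod_congr rfl
    intro i _
    rw [← Matrix.mul_apply, (h i).2]

lemma tens_one {ι D : Type} [Fintype ι] [DecidableEq ι] [Fintype D] [DecidableEq D] :
    tens (fun _ : ι => (1 : Matrix D D ℂ)) = 1 := by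
  ext g g'
  simp only [tens, Matrix.of_apply, Matrix.one_apply]
  by_cases h : g = g'
  · subst h; simp
  · rw [if_neg h]
    obtain ⟨i, hi⟩ := Function.ne_iff.mp h
    apply Finset.prod_eq_zero (Finset.mem_univ i)
    simp [hi]

lemma IsPr.posSemidef {D : Type} [Fintype D] {A : Matrix D D ℂ} (h : IsPr A) : A.PosSemidef := by
  have := Matrix.posSemidef_conjTranspose_mul_self A
  rwa [h.1, h.2] at this

lemma IsPr.one_sub {D : Type} [Fintype D] [DecidableEq D] {A : Matrix D D ℂ} (h : IsPr A) :
    IsPr (1 - A) := by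
  constructor
  · rw [Matrix.conjTranspose_sub, h.1, Matrix.conjTranspose_one]
  · simp [Matrix.sub_mul, Matrix.mul_sub, h.2]

/-- Local choice: identity, or rank-one projection. -/
def pm {d : ℕ} : Option (Fin d → ℂ) → Matrix (Fin d) (Fin d) ℂ
  | none => 1
  | some v => Matrix.of fun a b => star (v a) * v b

lemma pm_isPr {d : ℕ} (o : Option (Fin d → ℂ)) (h : ∀ v, o = some v → UnitVec v) : IsPr (pm o) := by
  cases o with
  | none => constructor <;> simp [pm]
  | some v =>
    have hv := h v rfl
    constructor
    · ext a b; simp [pm, mul_comm]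
    · ext a b
      simp only [pm, Matrix.mul_apply, Matrix.of_apply]
      have : ∀ x, star (v a) * v x * (star (v x) * v b) = (star (v a) * v b) * (star (v x) * v x) := by
        intro x; ring
      simp only [this]
      rw [← Finset.mul_sum]
      unfold UnitVec at hv
      rw [hv, mul_one]

/-- Single-copy probability (as a complex number). -/
def tauC {n d : ℕ} (Ψ : (Fin n → Fin d) → ℂ) (A : Fin n → Matrix (Fin d) (Fin d) ℂ) : ℂ :=
  ∑ h : Fin n → Fin d, ∑ h' : Fin n → Fin d,
    (∏ k, A k (h k) (h' k)) * (Ψ h' * star (Ψ h))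

/-- Single-copy probability. -/
def tau {n d : ℕ} (Ψ : (Fin n → Fin d) → ℂ) (o : Fin n → Option (Fin d → ℂ)) : ℝ :=
  (tauC Ψ (fun k => pm (o k))).re

lemma tauC_eq {n d : ℕ} (Ψ : (Fin n → Fin d) → ℂ) (A : Fin n → Matrix (Fin d) (Fin d) ℂ) :
    tauC Ψ A = star Ψ ⬝ᵥ (tens A) *ᵥ Ψ := by
  simp only [tauC, dotProduct, Matrix.mulVec, tens, Matrix.of_apply, Finset.mul_sum, Pi.star_apply]
  apply Finset.sum_congr rfl; intro h _
  apply Finset.sum_congr rfl; intro h' _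
  ring

lemma tau_props {n d : ℕ} (Ψ : (Fin n → Fin d) → ℂ) (hΨ : UnitVec Ψ)
    (o : Fin n → Option (Fin d → ℂ)) (h : ∀ k v, o k = some v → UnitVec v) :
    tauC Ψ (fun k => pm (o k)) = (tau Ψ o : ℂ) ∧ 0 ≤ tau Ψ o ∧ tau Ψ o ≤ 1 := by
  have hp : IsPr (tens fun k => pm (o k)) := tens_isPr _ fun k => pm_isPr _ (h k)
  have h1 := hp.posSemidef.dotProduct_mulVec_nonneg Ψ
  have h2 := hp.one_sub.posSemidef.dotProduct_mulVec_nonneg Ψ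
  rw [← tauC_eq] at h1
  rw [Matrix.sub_mulVec, Matrix.one_mulVec, dotProduct_sub, ← tauC_eq] at h2
  have h3 : star Ψ ⬝ᵥ Ψ = 1 := hΨ
  rw [h3] at h2
  rw [Complex.le_def] at h1 h2
  simp only [Complex.zero_re, Complex.zero_im, Complex.sub_re, Complex.one_re] at h1 h2
  refine ⟨?_, h1.1, ?_⟩
  · apply Complex.ext
    · simp [tau]
    · rw [← h1.2]; simp
  · unfold tau; linarith [h2.1]

lemma tauC_rank_one {n d : ℕ} (Ψ : (Fin n → Fin d) → ℂ) (v : Fin n → Fin d → ℂ) :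
    tauC Ψ (fun k => pm (some (v k))) = ((‖amp Ψ v‖ ^ 2 : ℝ) : ℂ) := by
  have : ((‖amp Ψ v‖ ^ 2 : ℝ) : ℂ) = star (amp Ψ v) * amp Ψ v := by
    push_cast; exact (Complex.conj_mul' _).symm
  rw [this, amp_apply, star_sum, Finset.sum_mul_sum]
  unfold tauC
  apply Finset.sum_congr rfl; intro h _
  apply Finset.sum_congr rfl; intro h' _
  simp only [pm, Matrix.of_apply, Finset.prod_mul_distrib, star_mul', star_prod]
  ring

lemma tau_rank_one {n d : ℕ} (Ψ : (Fin n → Fin d) → ℂ) (v : Fin n → Fin d → ℂ) :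
    tau Ψ (fun k => some (v k)) = ‖amp Ψ v‖ ^ 2 := by
  unfold tau; rw [tauC_rank_one, Complex.ofReal_re]

lemma tauC_update_sum {n d : ℕ} (Ψ : (Fin n → Fin d) → ℂ) (A : Fin n → Matrix (Fin d) (Fin d) ℂ)
    (j : Fin n) {β : Type} [Fintype β] (B : β → Matrix (Fin d) (Fin d) ℂ) :
    tauC Ψ (Function.update A j (∑ b, B b)) = ∑ b, tauC Ψ (Function.update A j (B b)) := by
  have key : ∀ (C : Matrix (Fin d) (Fin d) ℂ) (h h' : Fin n → Fin d),
      ∏ k, Function.update A j C k (h k) (h' k) =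
        C (h j) (h' j) * ∏ k ∈ univ.erase j, A k (h k) (h' k) := by
    intro C h h'
    rw [← Finset.mul_prod_erase univ _ (Finset.mem_univ j)]
    congr 1
    · simp
    · apply Finset.prod_congr rfl
      intro k hk
      rw [Function.update_of_ne (Finset.ne_of_mem_erase hk)]
  unfold tauC
  simp only [key]
  rw [Finset.sum_comm]
  conv_rhs => rw [Finset.sum_comm]; 
  simp only [Matrix.sum_apply, Finset.sum_mul]
  rw [Finset.sum_comm]
  apply Finset.sum_congr rfl; intro h _
  rw [Finset.sum_comm]

lemma tau_none {n d : ℕ} (Ψ : (Fin n → Fin d) → ℂ) (v : Fin n → Fin d → ℂ) (j : Fin n) :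
    tau Ψ (Function.update (fun k => some (v k)) j none) =
      ∑ b, ‖amp Ψ (Function.update v j (Pi.single b 1))‖ ^ 2 := by
  have h1 : (fun k => pm (Function.update (fun k => some (v k)) j none k)) =
      Function.update (fun k => pm (some (v k))) j
        (∑ b, pm (some (Pi.single b 1 : Fin d → ℂ))) := by
    ext k : 1
    by_cases hk : k = j
    · subst hk
      simp only [Function.update_self]
      ext a b
      simp [pm, Matrix.sum_apply, Matrix.one_apply, Pi.single_apply]
    · simp [hk]
  unfold tau
  rw [h1, tauC_update_sum]
  have h2 : ∀ b, tauC Ψ (Function.update (fun k => pm (some (v k))) j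
      (pm (some (Pi.single b 1 : Fin d → ℂ)))) =
      ((‖amp Ψ (Function.update v j (Pi.single b 1))‖ ^ 2 : ℝ) : ℂ) := by
    intro b
    rw [← tauC_rank_one]
    congr 1
    ext k : 1
    by_cases hk : k = j
    · subst hk; simp
    · simp [hk]
  simp only [h2]
  rw [← Complex.ofReal_sum, Complex.ofReal_re]

/-- Multi-copy value. -/
def valC {m n d : ℕ} (Ψ : (Fin n → Fin d) → ℂ)
    (F : Fin n → Matrix (Fin m → Fin d) (Fin m → Fin d) ℂ) : ℂ :=
  ∑ g : Fin m → Fin n → Fin d, ∑ g' : Fin m → Fin n → Fin d,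
    (∏ i, F i (fun c => g c i) (fun c => g' c i)) * ((∏ c, Ψ (g' c)) * star (∏ c, Ψ (g c)))

lemma valC_tens {m n d : ℕ} (Ψ : (Fin n → Fin d) → ℂ)
    (A : Fin n → Fin m → Matrix (Fin d) (Fin d) ℂ) :
    valC Ψ (fun i => tens (A i)) = ∏ c, tauC Ψ (fun i => A i c) := by
  unfold tauC
  rw [prod_sum_fun (fun c h => ∑ h' : Fin n → Fin d,
    (∏ k, A k c (h k) (h' k)) * (Ψ h' * star (Ψ h)))]
  unfold valC
  apply Finset.sum_congr rfl; intro g _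
  rw [prod_sum_fun (fun c h' => (∏ k, A k c (g c k) (h' k)) * (Ψ h' * star (Ψ (g c))))]
  apply Finset.sum_congr rfl; intro g' _
  simp only [tens, Matrix.of_apply, Finset.prod_mul_distrib, star_prod]
  rw [Finset.prod_comm]

lemma valC_update_sub {m n d : ℕ} (Ψ : (Fin n → Fin d) → ℂ)
    (F : Fin n → Matrix (Fin m → Fin d) (Fin m → Fin d) ℂ) (j : Fin n)
    (B C : Matrix (Fin m → Fin d) (Fin m → Fin d) ℂ) :
    valC Ψ (Function.update F j (B - C)) =
      valC Ψ (Function.update F j B) - valC Ψ (Function.update F j C) := by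
  have key : ∀ (C : Matrix (Fin m → Fin d) (Fin m → Fin d) ℂ) (h h' : Fin m → Fin n → Fin d),
      ∏ k, Function.update F j C k (fun c => h c k) (fun c => h' c k) =
        C (fun c => h c j) (fun c => h' c j) *
          ∏ k ∈ univ.erase j, F k (fun c => h c k) (fun c => h' c k) := by
    intro C h h'
    rw [← Finset.mul_prod_erase univ _ (Finset.mem_univ j)]
    congr 1
    · simp
    · apply Finset.prod_congr rfl
      intro k hk
      rw [Function.update_of_ne (Finset.ne_of_mem_erase hk)]
  unfold valC
  simp only [key, Matrix.sub_apply, sub_mul, Finset.sum_sub_distrib]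


lemma ns_const {κ X : Type} [Fintype κ] [DecidableEq κ] [Fintype X]
    (Q : (κ → X) → (κ → Fin 2) → ℝ)
    (hNS : NonSignalling (X := fun _ : κ => X) (A := fun _ : κ => Fin 2) Q) (i : κ) (x0 : κ → X) :
    ∃ q, ∀ x, Q (Function.update x0 i x) 0 +
      Q (Function.update x0 i x) (Function.update 0 i 1) = q := by
  have hfil : ∀ x, ∑ a ∈ univ.filter (fun a : κ → Fin 2 => ∀ k ∈ univ.erase i, a k = (0 : κ → Fin 2) k),
      Q x a = Q x 0 + Q x (Function.update 0 i 1) := by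
    intro x
    have hne : (0 : κ → Fin 2) ≠ Function.update (0 : κ → Fin 2) i 1 := by
      intro h
      have := congrFun h i
      simp at this
    rw [← Finset.sum_pair hne]
    apply Finset.sum_congr _ (fun _ _ => rfl)
    ext a
    simp only [Finset.mem_filter, Finset.mem_univ, true_and, Finset.mem_erase, and_true,
      Pi.zero_apply, Finset.mem_insert, Finset.mem_singleton]
    constructor
    · intro h
      have h2 : a i = 0 ∨ a i = 1 := by
        generalize a i = z
        fin_cases z <;> simp
      rcases h2 with h2 | h2
      · left; ext k : 1
        by_cases hk : k = i
        · subst hk; simpa using h2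
        · simpa using h k hk
      · right; ext k : 1
        by_cases hk : k = i
        · subst hk; simpa using h2
        · simpa [hk] using h k hk
    · rintro (h | h) k hk
      · simp [h]
      · simp [h, hk]
  by_cases hX : Nonempty X
  · obtain ⟨z⟩ := hX
    refine ⟨Q (Function.update x0 i z) 0 + Q (Function.update x0 i z) (Function.update 0 i 1), ?_⟩
    intro x
    rw [← hfil, ← hfil]
    have := hNS (univ.erase i) (Function.update x0 i x) (Function.update x0 i z) (by
      intro k hk
      have := Finset.ne_of_mem_erase hk
      simp [this]) 0
    convert this using 2 <;> (ext a; simp)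
  · exact ⟨0, fun x => (hX ⟨x⟩).elim⟩

/-- The box `G` factorizes along the pair `i`, `j` (around the base input `x0` and outputs `0`). -/
def Fac {ι X : Type} [DecidableEq ι] (G : (ι → X) → (ι → Fin 2) → ℝ) (x0 : ι → X) (i j : ι) : Prop :=
  ∃ (α β : X → ℝ) (q r : ℝ), (∀ x, 0 ≤ α x ∧ α x ≤ q) ∧ (∀ y, 0 ≤ β y ∧ β y ≤ r) ∧
    ∀ x y, G (Function.update (Function.update x0 i x) j y) 0 = α x * β y ∧
      G (Function.update (Function.update x0 i x) j y) (Function.update 0 j 1) = α x * (r - β y) ∧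
      G (Function.update (Function.update x0 i x) j y) (Function.update 0 i 1) = (q - α x) * β y

lemma fac_core {ι X : Type} [Fintype ι] [DecidableEq ι] [Fintype X] (p p' : ι → Prop)
    [Fintype {k // p k}] [Fintype {k // p' k}] [DecidableEq {k // p k}] [DecidableEq {k // p' k}]
    (G : (ι → X) → (ι → Fin 2) → ℝ) (x0 : ι → X) (i j : ι)
    (hi : p i) (hj : ¬ p j) (hj' : p' j) (hi' : ¬ p' i)
    (Q : ({k // p k} → X) → ({k // p k} → Fin 2) → ℝ)
    (R : ({k // p' k} → X) → ({k // p' k} → Fin 2) → ℝ)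
    (hG : ∀ x a, G x a = Q (fun k => x k.1) (fun k => a k.1) * R (fun k => x k.1) (fun k => a k.1))
    (hQB : IsBoxN (X := fun _ : {k // p k} => X) (A := fun _ : {k // p k} => Fin 2) Q)
    (hRB : IsBoxN (X := fun _ : {k // p' k} => X) (A := fun _ : {k // p' k} => Fin 2) R)
    (hQ : NonSignalling (X := fun _ : {k // p k} => X) (A := fun _ : {k // p k} => Fin 2) Q)
    (hR : NonSignalling (X := fun _ : {k // p' k} => X) (A := fun _ : {k // p' k} => Fin 2) R) :
    Fac G x0 i j := by
  obtain ⟨q, hq⟩ := ns_const Q hQ ⟨i, hi⟩ (fun k => x0 k.1)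
  obtain ⟨r, hr⟩ := ns_const R hR ⟨j, hj'⟩ (fun k => x0 k.1)
  have hji : j ≠ i := fun h => hj (h ▸ hi)
  have res1 : ∀ {Y : Type} (f : ι → Y) (x y : Y),
      (fun k : {k // p k} => Function.update (Function.update f i x) j y k.1) =
        Function.update (fun k : {k // p k} => f k.1) ⟨i, hi⟩ x := by
    intro Y f x y
    ext k : 1
    have hk1 : k.1 ≠ j := fun h => hj (h ▸ k.2)
    by_cases hk : k = ⟨i, hi⟩
    · subst hk; simp [hk1]
    · have : k.1 ≠ i := fun h => hk (Subtype.ext h)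
      simp [hk1, hk, this]
  have res2 : ∀ {Y : Type} (f : ι → Y) (x y : Y),
      (fun k : {k // p' k} => Function.update (Function.update f i x) j y k.1) =
        Function.update (fun k : {k // p' k} => f k.1) ⟨j, hj'⟩ y := by
    intro Y f x y
    ext k : 1
    have hk1 : k.1 ≠ i := fun h => hi' (h ▸ k.2)
    by_cases hk : k = ⟨j, hj'⟩
    · subst hk; simp
    · have : k.1 ≠ j := fun h => hk (Subtype.ext h)
      simp [hk1, hk, this]
  have z1 : (fun k : {k // p k} => (0 : ι → Fin 2) k.1) = 0 := rfl
  have z2 : (fun k : {k // p' k} => (0 : ι → Fin 2) k.1) = 0 := rfl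
  have uj : (Function.update (0 : ι → Fin 2) j 1) = Function.update (Function.update (0 : ι → Fin 2) i 0) j 1 := by
    congr 1; simp
  have ui : (Function.update (0 : ι → Fin 2) i 1) = Function.update (Function.update (0 : ι → Fin 2) i 1) j 0 := by
    symm; apply Function.update_eq_self_iff.mpr; simp [hji]
  refine ⟨fun x => Q (Function.update (fun k => x0 k.1) ⟨i, hi⟩ x) 0,
    fun y => R (Function.update (fun k => x0 k.1) ⟨j, hj'⟩ y) 0, q, r, ?_, ?_, ?_⟩
  · intro x
    refine ⟨hQB.1 _ _, ?_⟩
    have := hq x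
    have h2 := hQB.1 (Function.update (fun k => x0 k.1) ⟨i, hi⟩ x) (Function.update 0 ⟨i, hi⟩ 1)
    linarith
  · intro x
    refine ⟨hRB.1 _ _, ?_⟩
    have := hr x
    have h2 := hRB.1 (Function.update (fun k => x0 k.1) ⟨j, hj'⟩ x) (Function.update 0 ⟨j, hj'⟩ 1)
    linarith
  · intro x y
    have e1 := hq x
    have e2 := hr y
    refine ⟨?_, ?_, ?_⟩
    · rw [hG, res1, res2, z1, z2]
    · rw [hG, uj, res1, res2, res1, res2, z1, z2]
      have : (Function.update 0 (⟨i, hi⟩ : {k // p k}) 0 : {k // p k} → Fin 2) = 0 := by simp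
      rw [this, ← e2]; ring
    · rw [hG, ui, res1, res2, res1, res2, z1, z2]
      have : (Function.update 0 (⟨j, hj'⟩ : {k // p' k}) 0 : {k // p' k} → Fin 2) = 0 := by simp
      rw [this, ← e1]; ring

/-- The error terms of the chained inequality. -/
def cost {ι X : Type} [DecidableEq ι] (G : (ι → X) → (ι → Fin 2) → ℝ) (x0 : ι → X) (i j : ι)
    (N : ℕ) (a b : ℕ → X) : ℝ :=
  ∑ k ∈ range N,
    (G (Function.update (Function.update x0 i (a k)) j (b (k + 1))) (Function.update 0 j 1) +
     G (Function.update (Function.update x0 i (a (k + 1))) j (b (k + 1))) (Function.update 0 i 1)) +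
  G (Function.update (Function.update x0 i (a N)) j (b 0)) 0

lemma chain_step (α α' β0 β' q r : ℝ) (h1 : 0 ≤ α) (h1' : α ≤ q) (h2 : 0 ≤ α') (h2' : α' ≤ q)
    (h3 : 0 ≤ β0) (h3' : β0 ≤ r) (h4 : 0 ≤ β') (h4' : β' ≤ r) :
    α * β0 ≤ α * (r - β') + (q - α') * β' + α' * β0 := by
  rcases le_total β' β0 with h | h
  · nlinarith [mul_nonneg h1 (sub_nonneg.mpr h3'), mul_nonneg h4 (sub_nonneg.mpr h1'),
      mul_nonneg h2 (sub_nonneg.mpr h)]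
  · have e1 : α' * (β' - β0) ≤ q * (β' - β0) := mul_le_mul_of_nonneg_right h2' (by linarith)
    rcases le_total (β0 + β' - r) 0 with h5 | h5
    · nlinarith [mul_nonneg h1 (neg_nonneg.mpr h5), mul_nonneg (h1.trans h1') h3]
    · nlinarith [mul_nonneg (sub_nonneg.mpr h1') h5,
        mul_nonneg (h1.trans h1') (sub_nonneg.mpr h4')]

lemma fac_chain {ι X : Type} [DecidableEq ι] (G : (ι → X) → (ι → Fin 2) → ℝ) (x0 : ι → X) (i j : ι)
    (N : ℕ) (a b : ℕ → X) (ha : a 0 = x0 i) (hb : b 0 = x0 j) (h : Fac G x0 i j) :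
    G x0 0 ≤ cost G x0 i j N a b := by
  obtain ⟨α, β, q, r, hα, hβ, hG⟩ := h
  have h0 : G x0 0 = α (a 0) * β (b 0) := by
    have := (hG (x0 i) (x0 j)).1
    rw [Function.update_eq_self, Function.update_eq_self] at this
    rw [this, ha, hb]
  have hind : ∀ N, α (a 0) * β (b 0) ≤ cost G x0 i j N a b := by
    intro N
    induction N with
    | zero => simp [cost, (hG _ _).1]
    | succ N ih =>
      refine ih.trans ?_
      simp only [cost, Finset.sum_range_succ, (hG _ _).1, (hG _ _).2.1, (hG _ _).2.2]
      have := chain_step (α (a N)) (α (a (N + 1))) (β (b 0)) (β (b (N + 1))) q r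
        (hα _).1 (hα _).2 (hα _).1 (hα _).2 (hβ _).1 (hβ _).2 (hβ _).1 (hβ _).2
      linarith
  rw [h0]; exact hind N

lemma bilocal_ineq {ι X κ : Type} [Fintype ι] [DecidableEq ι] [Fintype X] [Fintype κ]
    (P : (ι → X) → (ι → Fin 2) → ℝ)
    (hP : Bilocal (X := fun _ : ι => X) (A := fun _ : ι => Fin 2) P) (x0 : ι → X)
    (i j : κ → ι) (N : κ → ℕ) (a b : κ → ℕ → X)
    (ha : ∀ c, a c 0 = x0 (i c)) (hb : ∀ c, b c 0 = x0 (j c))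
    (hcross : ∀ M : Finset ι, M.Nonempty → M ≠ univ →
      ∃ c, (i c ∈ M ∧ j c ∉ M) ∨ (i c ∉ M ∧ j c ∈ M)) :
    P x0 0 ≤ ∑ c, cost P x0 (i c) (j c) (N c) (a c) (b c) := by
  obtain ⟨L, M, w, Q, R, hM, hw, hw1, hQ, hR, hPe⟩ := hP
  set G : Fin L → (ι → X) → (ι → Fin 2) → ℝ := fun l x a =>
    Q l (fun k => x k.1) (fun k => a k.1) * R l (fun k => x k.1) (fun k => a k.1) with hG
  have hGe : ∀ x a, P x a = ∑ l, w l * G l x a := by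
    intro x a; rw [hPe]; apply Finset.sum_congr rfl; intro l _; simp only [hG]; ring
  have hG0 : ∀ l x a, 0 ≤ G l x a := fun l x a => mul_nonneg ((hQ l).1.1 _ _) ((hR l).1.1 _ _)
  have hcost : ∀ c, cost P x0 (i c) (j c) (N c) (a c) (b c) =
      ∑ l, w l * cost (G l) x0 (i c) (j c) (N c) (a c) (b c) := by
    intro c
    simp only [cost, hGe, mul_add, Finset.mul_sum, Finset.sum_add_distrib]
    rw [Finset.sum_comm, Finset.sum_comm (s := range (N c))]
  have hcn : ∀ l c, 0 ≤ cost (G l) x0 (i c) (j c) (N c) (a c) (b c) := by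
    intro l c
    unfold cost
    apply add_nonneg _ (hG0 _ _ _)
    apply Finset.sum_nonneg
    intro k _
    exact add_nonneg (hG0 _ _ _) (hG0 _ _ _)
  simp only [hcost]
  rw [Finset.sum_comm, hGe]
  apply Finset.sum_le_sum
  intro l _
  rw [← Finset.mul_sum]
  apply mul_le_mul_of_nonneg_left _ (hw l)
  obtain ⟨c, hc⟩ := hcross (M l) (hM l).1 (hM l).2
  have hfac : Fac (G l) x0 (i c) (j c) := by
    rcases hc with ⟨h1, h2⟩ | ⟨h1, h2⟩
    · exact fac_core (fun k => k ∈ M l) (fun k => k ∉ M l) (G l) x0 (i c) (j c) h1 h2 h2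
        (not_not.mpr h1) (Q l) (R l) (fun _ _ => rfl) (hQ l).1 (hR l).1 (hQ l).2 (hR l).2
    · exact fac_core (fun k => k ∉ M l) (fun k => k ∈ M l) (G l) x0 (i c) (j c) h1
        (not_not.mpr h2) h2 h1 (R l) (Q l) (fun _ _ => mul_comm _ _) (hR l).1 (hQ l).1
        (hR l).2 (hQ l).2
  refine (fac_chain (G l) x0 (i c) (j c) (N c) (a c) (b c) (ha c) (hb c) hfac).trans ?_
  exact Finset.single_le_sum (f := fun c => cost (G l) x0 (i c) (j c) (N c) (a c) (b c))
    (fun c _ => hcn l c) (Finset.mem_univ c)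


lemma tree_edges (n : ℕ) (hn : 2 ≤ n) (R : Fin n → Fin n → Prop)
    (hsymm : ∀ i j, R i j → R j i)
    (hcut : ∀ M : Finset (Fin n), M.Nonempty → M ≠ univ → ∃ i ∈ M, ∃ j, j ∉ M ∧ R i j) :
    ∃ i j : Fin (n - 1) → Fin n, (∀ c, i c ≠ j c ∧ R (i c) (j c)) ∧
      ∀ M : Finset (Fin n), M.Nonempty → M ≠ univ →
        ∃ c, (i c ∈ M ∧ j c ∉ M) ∨ (i c ∉ M ∧ j c ∈ M) := by
  let G : SimpleGraph (Fin n) :=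
    { Adj := fun i j => i ≠ j ∧ R i j
      symm := ⟨fun i j h => ⟨h.1.symm, hsymm _ _ h.2⟩⟩
      loopless := ⟨fun i h => h.1 rfl⟩ }
  have hG : G.Connected := by
    have : Nonempty (Fin n) := ⟨⟨0, by omega⟩⟩
    refine ⟨?_⟩
    intro a b
    by_contra hab
    obtain ⟨i, hi, j, hj, hR⟩ := hcut (univ.filter fun k => G.Reachable a k)
      ⟨a, by simp⟩ (by
        intro h
        have : b ∈ univ.filter fun k => G.Reachable a k := by rw [h]; exact Finset.mem_univ b
        simp at this
        exact hab this)
    simp only [Finset.mem_filter, Finset.mem_univ, true_and] at hi hj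
    apply hj
    refine hi.trans (SimpleGraph.Adj.reachable ?_)
    refine ⟨?_, hR⟩
    rintro rfl
    exact hj hi
  obtain ⟨T, hTG, hT⟩ := hG.exists_isTree_le
  have hcard : Fintype.card T.edgeSet = n - 1 := by
    have := hT.card_edgeFinset
    rw [SimpleGraph.edgeFinset_card, Fintype.card_fin] at this
    omega
  let e : Fin (n - 1) ≃ T.edgeSet := (Fintype.equivFinOfCardEq hcard).symm
  have hrep : ∀ c, ∃ p : Fin n × Fin n, (e c).1 = s(p.1, p.2) := by
    intro c
    induction h : (e c).1 with
    | _ x y => exact ⟨(x, y), rfl⟩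
  choose p hp using hrep
  refine ⟨fun c => (p c).1, fun c => (p c).2, ?_, ?_⟩
  · intro c
    have h1 : T.Adj (p c).1 (p c).2 := by
      rw [← SimpleGraph.mem_edgeSet, ← hp]; exact (e c).2
    exact hTG h1
  · intro M hM hM'
    obtain ⟨a, ha⟩ := hM
    obtain ⟨b, hb⟩ : ∃ b, b ∉ M := by
      by_contra h
      push Not at h
      exact hM' (Finset.eq_univ_iff_forall.mpr h)
    obtain ⟨W⟩ := hT.1.preconnected a b
    obtain ⟨dd, -, h1, h2⟩ := W.exists_boundary_dart (M : Set (Fin n)) ha hb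
    have hmem : s(dd.fst, dd.snd) ∈ T.edgeSet := (SimpleGraph.mem_edgeSet _).mpr dd.adj
    obtain ⟨c, hc⟩ := e.surjective ⟨s(dd.fst, dd.snd), hmem⟩
    refine ⟨c, ?_⟩
    have h3 := hp c
    rw [hc] at h3
    simp only [Sym2.eq_iff] at h3
    show ((p c).1 ∈ M ∧ (p c).2 ∉ M) ∨ ((p c).1 ∉ M ∧ (p c).2 ∈ M)
    rcases h3 with ⟨h3, h4⟩ | ⟨h3, h4⟩
    · left; rw [← h3, ← h4]; exact ⟨h1, h2⟩
    · right; rw [← h3, ← h4]; exact ⟨h2, h1⟩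

/-- The two-outcome measurement determined by a local choice in each copy. -/
def meas {m d : ℕ} (l : Fin m → Option (Fin d → ℂ)) (a : Fin 2) :
    Matrix (Fin m → Fin d) (Fin m → Fin d) ℂ :=
  if a = 0 then tens (fun c => pm (l c)) else 1 - tens (fun c => pm (l c))

lemma meas_psd {m d : ℕ} (l : Fin m → Option (Fin d → ℂ)) (h : ∀ c v, l c = some v → UnitVec v)
    (a : Fin 2) : (meas l a).PosSemidef := by
  have h1 : IsPr (tens (fun c => pm (l c))) := tens_isPr _ fun c => pm_isPr _ (h c)
  unfold meas
  split_ifs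
  · exact h1.posSemidef
  · exact h1.one_sub.posSemidef

lemma meas_sum {m d : ℕ} (l : Fin m → Option (Fin d → ℂ)) : ∑ a, meas l a = 1 := by
  simp [meas, Fin.sum_univ_two]

lemma box_zero {m n d : ℕ} (Ψ : (Fin n → Fin d) → ℂ) (hΨ : UnitVec Ψ)
    (l : Fin n → Fin m → Option (Fin d → ℂ)) (h : ∀ k c v, l k c = some v → UnitVec v) :
    (valC Ψ (fun k => meas (l k) ((0 : Fin n → Fin 2) k))).re = ∏ c, tau Ψ (fun k => l k c) := by
  have : (fun k => meas (l k) ((0 : Fin n → Fin 2) k)) = fun k => tens (fun c => pm (l k c)) := by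
    ext k : 1; simp [meas]
  rw [this, valC_tens]
  have h2 : ∀ c, tauC Ψ (fun k => pm (l k c)) = (tau Ψ (fun k => l k c) : ℂ) :=
    fun c => (tau_props Ψ hΨ _ (fun k => h k c)).1
  simp only [h2]
  rw [← Complex.ofReal_prod, Complex.ofReal_re]

lemma box_one {m n d : ℕ} (Ψ : (Fin n → Fin d) → ℂ) (hΨ : UnitVec Ψ)
    (l : Fin n → Fin m → Option (Fin d → ℂ)) (h : ∀ k c v, l k c = some v → UnitVec v)
    (j : Fin n) :
    (valC Ψ (fun k => meas (l k) (Function.update (0 : Fin n → Fin 2) j 1 k))).re =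
      ∏ c, tau Ψ (Function.update (fun k => l k c) j none) - ∏ c, tau Ψ (fun k => l k c) := by
  have e1 : (fun k => meas (l k) (Function.update (0 : Fin n → Fin 2) j 1 k)) =
      Function.update (fun k => meas (l k) ((0 : Fin n → Fin 2) k)) j
        (1 - tens (fun c => pm (l j c))) := by
    ext k : 1
    by_cases hk : k = j
    · subst hk; simp [meas]
    · simp [hk]
  have e2 : Function.update (fun k => meas (l k) ((0 : Fin n → Fin 2) k)) j
        (tens (fun c => pm (l j c))) = fun k => meas (l k) ((0 : Fin n → Fin 2) k) := by
    apply Function.update_eq_self_iff.mpr; simp [meas]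
  have e3 : Function.update (fun k => meas (l k) ((0 : Fin n → Fin 2) k)) j 1 =
      fun k => meas (Function.update l j (fun _ => none) k) ((0 : Fin n → Fin 2) k) := by
    ext k : 1
    by_cases hk : k = j
    · subst hk; simp [meas, pm, tens_one]
    · simp [hk]
  rw [e1, valC_update_sub, Complex.sub_re, e2, box_zero Ψ hΨ l h, e3, box_zero Ψ hΨ]
  · congr 1
    apply Finset.prod_congr rfl
    intro c _
    congr 1
    ext k : 1
    by_cases hk : k = j
    · subst hk; simp
    · simp [hk]
  · intro k c v
    by_cases hk : k = j
    · subst hk; simp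
    · simp only [ne_eq, hk, not_false_eq_true, Function.update_of_ne]; exact h k c v

lemma prod_diff {κ : Type} [Fintype κ] [DecidableEq κ] (f g : κ → ℝ) (c : κ) (η : ℝ) (hη : 0 ≤ η)
    (h0 : ∀ c, 0 ≤ f c ∧ f c ≤ 1) (hne : ∀ c', c' ≠ c → f c' = g c') (hc : f c - g c ≤ η) :
    ∏ c, f c - ∏ c, g c ≤ η := by
  rw [← Finset.mul_prod_erase univ f (Finset.mem_univ c),
    ← Finset.mul_prod_erase univ g (Finset.mem_univ c)]
  have : ∏ x ∈ univ.erase c, g x = ∏ x ∈ univ.erase c, f x :=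
    Finset.prod_congr rfl fun x hx => (hne x (Finset.ne_of_mem_erase hx)).symm
  rw [this, ← sub_mul]
  have h1 : 0 ≤ ∏ x ∈ univ.erase c, f x := Finset.prod_nonneg fun x _ => (h0 x).1
  have h2 : ∏ x ∈ univ.erase c, f x ≤ 1 := Finset.prod_le_one (fun x _ => (h0 x).1) fun x _ => (h0 x).2
  nlinarith

lemma prod_le_factor {κ : Type} [Fintype κ] [DecidableEq κ] (f : κ → ℝ) (c : κ)
    (h0 : ∀ c, 0 ≤ f c ∧ f c ≤ 1) : ∏ c, f c ≤ f c := by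
  rw [← Finset.mul_prod_erase univ f (Finset.mem_univ c)]
  have h2 : ∏ x ∈ univ.erase c, f x ≤ 1 := Finset.prod_le_one (fun x _ => (h0 x).1) fun x _ => (h0 x).2
  exact mul_le_of_le_one_right (h0 c).1 h2

/-- The local choices. -/
def loc {m n d S : ℕ} (i j : Fin m → Fin n) (w : Fin m → Fin n → Fin d → ℂ)
    (u v : Fin m → ℕ → Fin d → ℂ) (k : Fin n) :
    Option (Fin m × Fin (S + 1)) → Fin m → Option (Fin d → ℂ)
  | none, c => some (Function.update (Function.update (w c) (i c) (u c 0)) (j c) (v c 0) k)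
  | some (c', s), c => if c = c' then
      (if k = i c then some (u c s) else if k = j c then some (v c s) else none) else none

/-- The inputs used along an edge. -/
def inp {m S : ℕ} (c : Fin m) (s : ℕ) : Option (Fin m × Fin (S + 1)) :=
  if s = 0 then none else some (c, Fin.ofNat (S + 1) s)

lemma loc_unit {m n d S : ℕ} (i j : Fin m → Fin n) (w : Fin m → Fin n → Fin d → ℂ)
    (u v : Fin m → ℕ → Fin d → ℂ) (hw : ∀ c k, k ≠ i c → k ≠ j c → UnitVec (w c k))
    (hu : ∀ c s, UnitVec (u c s)) (hv : ∀ c s, UnitVec (v c s)) (k : Fin n)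
    (x : Option (Fin m × Fin (S + 1))) (c : Fin m) (z : Fin d → ℂ)
    (h : loc i j w u v k x c = some z) : UnitVec z := by
  rcases x with _ | ⟨c', s⟩
  · simp only [loc, Option.some.injEq] at h
    subst h
    by_cases h1 : k = j c
    · subst h1; simp [hv]
    · by_cases h2 : k = i c
      · subst h2; simp [h1, hu]
      · simp [h1, h2, hw]
  · simp only [loc] at h
    split_ifs at h <;> simp only [Option.some.injEq] at h <;> subst h
    · exact hu _ _
    · exact hv _ _

lemma loc_other {m n d S : ℕ} (i j : Fin m → Fin n) (w : Fin m → Fin n → Fin d → ℂ)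
    (u v : Fin m → ℕ → Fin d → ℂ) (k : Fin n) (c c' : Fin m) (hc : c' ≠ c) (s : ℕ) (hs : s ≠ 0) :
    loc (S := S) i j w u v k (inp c s) c' = none := by
  simp [inp, hs, loc, hc]

lemma loc_main {m n d S : ℕ} (i j : Fin m → Fin n) (w : Fin m → Fin n → Fin d → ℂ)
    (u v : Fin m → ℕ → Fin d → ℂ) (c : Fin m) (hij : i c ≠ j c) (s t : ℕ) (hs : s ≤ S) (ht : t ≤ S)
    (k : Fin n) :
    loc (S := S) i j w u v k
      (Function.update (Function.update (fun _ => none) (i c) (inp c s)) (j c) (inp c t) k) c =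
    some (Function.update (Function.update (w c) (i c) (u c s)) (j c) (v c t) k) := by
  by_cases h1 : k = j c
  · subst h1
    by_cases ht0 : t = 0
    · subst ht0; simp [inp, loc]
    · simp [inp, loc, ht0, hij.symm, Nat.mod_eq_of_lt (Nat.lt_succ_of_le ht)]
  · by_cases h2 : k = i c
    · subst h2
      by_cases hs0 : s = 0
      · subst hs0; simp [inp, loc, h1]
      · simp [inp, loc, hs0, h1, Nat.mod_eq_of_lt (Nat.lt_succ_of_le hs)]
    · simp [loc, h1, h2]


lemma edge_cost {m n d S q : ℕ} (Ψ : (Fin n → Fin d) → ℂ) (hΨ : UnitVec Ψ)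
    (i j : Fin m → Fin n) (w : Fin m → Fin n → Fin d → ℂ)
    (u v : Fin m → ℕ → Fin d → ℂ) (hw : ∀ c k, k ≠ i c → k ≠ j c → UnitVec (w c k))
    (hu : ∀ c s, UnitVec (u c s)) (hv : ∀ c s, UnitVec (v c s))
    (e : Option (Fin m × Fin (S + 1)) ≃ Fin q) (c : Fin m) (hij : i c ≠ j c)
    (N : ℕ) (hN : N ≤ S) (η : ℝ) (hη : 0 ≤ η)
    (h1 : ∀ k < N, ∑ b, ‖amp2 Ψ (w c) (i c) (j c) (u c k) (Pi.single b 1)‖ ^ 2 -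
      ‖amp2 Ψ (w c) (i c) (j c) (u c k) (v c (k + 1))‖ ^ 2 ≤ η)
    (h2 : ∀ k < N, ∑ a, ‖amp2 Ψ (w c) (i c) (j c) (Pi.single a 1) (v c (k + 1))‖ ^ 2 -
      ‖amp2 Ψ (w c) (i c) (j c) (u c (k + 1)) (v c (k + 1))‖ ^ 2 ≤ η)
    (h3 : ‖amp2 Ψ (w c) (i c) (j c) (u c N) (v c 0)‖ ^ 2 ≤ η) :
    cost (fun (x : Fin n → Fin q) (a : Fin n → Fin 2) =>
        (valC Ψ (fun k => meas (loc i j w u v k (e.symm (x k))) (a k))).re)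
      (fun _ => e none) (i c) (j c) N (fun s => e (inp c s)) (fun s => e (inp c s)) ≤
      (2 * N + 1) * η := by
  set l : ℕ → ℕ → Fin n → Fin m → Option (Fin d → ℂ) := fun s t k =>
    loc (S := S) i j w u v k
      (Function.update (Function.update (fun _ => none) (i c) (inp c s)) (j c) (inp c t) k) with hl
  have hlu : ∀ s t k c v, l s t k c = some v → UnitVec v := fun s t k c' z h =>
    loc_unit i j w u v hw hu hv _ _ _ _ h
  have hx : ∀ s t k, e.symm (Function.update (Function.update (fun _ => e none) (i c) (e (inp c s)))
      (j c) (e (inp c t)) k) =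
      Function.update (Function.update (fun _ => none) (i c) (inp c s)) (j c) (inp c t) k := by
    intro s t k
    by_cases a1 : k = j c
    · subst a1; simp
    · by_cases a2 : k = i c
      · subst a2; simp [a1]
      · simp [a1, a2]
  have hlm : ∀ s t, s ≤ S → t ≤ S → (fun k => l s t k c) =
      fun k => some (Function.update (Function.update (w c) (i c) (u c s)) (j c) (v c t) k) := by
    intro s t hs ht
    ext k : 1
    exact loc_main i j w u v c hij s t hs ht k
  have hupd : ∀ s t (r : Fin n) c' k z, Function.update (fun k => l s t k c') r none k = some z →
      UnitVec z := by
    intro s t r c' k z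
    by_cases hk : k = r
    · subst hk; simp
    · simp only [ne_eq, hk, not_false_eq_true, Function.update_of_ne]; exact hlu s t k c' z
  have t1 : ∀ k < N, (valC Ψ (fun r => meas (l k (k + 1) r)
      (Function.update (0 : Fin n → Fin 2) (j c) 1 r))).re ≤ η := by
    intro k hk
    rw [box_one Ψ hΨ _ (hlu _ _)]
    apply prod_diff _ _ c η hη
    · intro c'; exact (tau_props Ψ hΨ _ (hupd _ _ _ _)).2
    · intro c' hc'
      congr 1
      apply Function.update_eq_self_iff.mpr
      simp only [hl, Function.update_self]
      rw [loc_other i j w u v _ c c' hc' _ (by omega)]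
    · rw [hlm k (k + 1) (by omega) (by omega), tau_none, tau_rank_one]
      simp only [Function.update_idem]
      exact h1 k hk
  have t2 : ∀ k < N, (valC Ψ (fun r => meas (l (k + 1) (k + 1) r)
      (Function.update (0 : Fin n → Fin 2) (i c) 1 r))).re ≤ η := by
    intro k hk
    rw [box_one Ψ hΨ _ (hlu _ _)]
    apply prod_diff _ _ c η hη
    · intro c'; exact (tau_props Ψ hΨ _ (hupd _ _ _ _)).2
    · intro c' hc'
      congr 1
      apply Function.update_eq_self_iff.mpr
      simp only [hl, Function.update_self, Function.update_of_ne hij]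
      rw [loc_other i j w u v _ c c' hc' _ (by omega)]
    · rw [hlm (k + 1) (k + 1) (by omega) (by omega), tau_none, tau_rank_one]
      have : ∀ b, Function.update (Function.update (Function.update (w c) (i c) (u c (k + 1)))
          (j c) (v c (k + 1))) (i c) b =
          Function.update (Function.update (w c) (i c) b) (j c) (v c (k + 1)) := by
        intro b
        rw [Function.update_comm hij.symm, Function.update_idem]
      simp only [this]
      exact h2 k hk
  have t3 : (valC Ψ (fun r => meas (l N 0 r) ((0 : Fin n → Fin 2) r))).re ≤ η := by
    rw [box_zero Ψ hΨ _ (hlu _ _)]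
    refine (prod_le_factor _ c fun c' => (tau_props Ψ hΨ _ (fun k => hlu _ _ k c')).2).trans ?_
    rw [hlm N 0 hN (Nat.zero_le _), tau_rank_one]
    exact h3
  unfold cost
  simp only [hx]
  have hs := Finset.sum_le_sum (s := range N) (g := fun _ => 2 * η) (f := fun k =>
    (valC Ψ (fun r => meas (l k (k + 1) r)
      (Function.update (0 : Fin n → Fin 2) (j c) 1 r))).re +
    (valC Ψ (fun r => meas (l (k + 1) (k + 1) r)
      (Function.update (0 : Fin n → Fin 2) (i c) 1 r))).re) (by
      intro k hk
      have a1 := t1 k (Finset.mem_range.mp hk)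
      have a2 := t2 k (Finset.mem_range.mp hk)
      linarith)
  rw [Finset.sum_const, Finset.card_range, nsmul_eq_mul] at hs
  have := add_le_add hs t3
  calc _ ≤ _ := this
    _ = _ := by ring


/-- **Finitely many copies of any GME pure state are GMNL.** If `Ψ` is a genuinely
multipartite entangled pure state of `n` parties, then `n−1` copies of it (party `i`
holding the `i`-th tensor factor of every copy) give rise, for suitable local POVMs,
to a non-bilocal box. -/
theorem copies_of_GME_state_are_GMNL (n d : ℕ) (hn : 2 ≤ n) (hd : 2 ≤ d)
    (Ψ : (Fin n → Fin d) → ℂ) (hunit : UnitVec Ψ)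
    (hGME : ¬ IsBisepVec (Idx := fun _ : Fin n => Fin d) Ψ) :
    ∃ (mX mA : Fin n → ℕ)
      (E : (i : Fin n) → Fin (mX i) → Fin (mA i) →
        Matrix (Fin (n - 1) → Fin d) (Fin (n - 1) → Fin d) ℂ),
      (∀ i x a, (E i x a).PosSemidef) ∧
      (∀ i x, ∑ a, E i x a = 1) ∧
      ¬ Bilocal (fun (x : ∀ i, Fin (mX i)) (a : ∀ i, Fin (mA i)) =>
        (∑ g : Fin (n - 1) → Fin n → Fin d, ∑ g' : Fin (n - 1) → Fin n → Fin d,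
          (∏ i, E i (x i) (a i) (fun c => g c i) (fun c => g' c i)) *
          ((∏ c, Ψ (g' c)) * star (∏ c, Ψ (g c)))).re) := by

  have hne : ∃ g, Ψ g ≠ 0 := by
    by_contra h
    push Not at h
    have : UnitVec Ψ := hunit
    simp [UnitVec, h] at this
  obtain ⟨i, j, hij, hcross⟩ := tree_edges n hn (fun i j => ¬ NoEnt (amp Ψ) {i} {j})
    (fun i j h h' => h h'.symm) (fun M hM hM' => cut_lemma Ψ hne hGME M hM hM')
  choose C hC hE using fun c => edge_data Ψ (i c) (j c) (hij c).1 (hij c).2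
  have hCpos : 0 < ∏ c, C c := Finset.prod_pos fun c _ => hC c
  have hnpos : (0 : ℝ) < n := by exact_mod_cast (by omega : 0 < n)
  choose N η w u v hη hNη hw hu hv h0 h1 h2 h3 using fun c => hE c ((∏ c, C c) / n) (by positivity)
  have hNS : ∀ c, N c ≤ ∑ c, N c := fun c =>
    Finset.single_le_sum (fun _ _ => Nat.zero_le _) (Finset.mem_univ c)
  generalize (∑ c, N c) = S at hNS
  let e := Fintype.equivFin (Option (Fin (n - 1) × Fin (S + 1)))
  refine ⟨fun _ => Fintype.card (Option (Fin (n - 1) × Fin (S + 1))), fun _ => 2,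
    fun k x a => meas (loc i j w u v k (e.symm x)) a, ?_, ?_, ?_⟩
  · intro k x a
    exact meas_psd _ (fun c z h => loc_unit i j w u v hw hu hv _ _ _ _ h) a
  · intro k x
    exact meas_sum _
  · intro hB
    have key := bilocal_ineq (κ := Fin (n - 1)) (fun (x : Fin n → Fin _) (a : Fin n → Fin 2) =>
        (valC Ψ (fun k => meas (loc i j w u v k (e.symm (x k))) (a k))).re) hB
      (fun _ => e none) i j N (fun c s => e (inp c s)) (fun c s => e (inp c s))
      (fun c => by simp [inp]) (fun c => by simp [inp]) hcross
    have hlow : ∏ c, C c ≤ (valC Ψ (fun k => meas (loc i j w u v k (e.symm (e none)))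
        ((0 : Fin n → Fin 2) k))).re := by
      rw [box_zero Ψ hunit _ (fun k c z h => loc_unit i j w u v hw hu hv _ _ _ _ h)]
      apply Finset.prod_le_prod (fun c _ => (hC c).le)
      intro c _
      simp only [Equiv.symm_apply_apply, loc]
      rw [tau_rank_one]
      exact h0 c
    have hup : ∑ c, cost (fun (x : Fin n → Fin _) (a : Fin n → Fin 2) =>
        (valC Ψ (fun k => meas (loc i j w u v k (e.symm (x k))) (a k))).re)
        (fun _ => e none) (i c) (j c) (N c) (fun s => e (inp c s)) (fun s => e (inp c s)) ≤
        ∑ _c : Fin (n - 1), (∏ c, C c) / n := by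
      apply Finset.sum_le_sum
      intro c _
      exact (edge_cost Ψ hunit i j w u v hw hu hv e c (hij c).1 (N c) (hNS c) (η c) (hη c)
        (h1 c) (h2 c) (h3 c)).trans (hNη c)
    rw [Finset.sum_const, Finset.card_univ, Fintype.card_fin, nsmul_eq_mul,
      Nat.cast_sub (by omega)] at hup
    have hfin : ((n : ℝ) - (1 : ℕ)) * ((∏ c, C c) / n) < ∏ c, C c := by
      rw [mul_div_assoc', div_lt_iff₀ hnpos]
      push_cast
      nlinarith
    have := (hlow.trans key).trans hup
    linarith
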